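/- arXiv:1909.02731 — 6 statements merged into one kernel-verified Lean document; each statement's English description precedes it below -/
import Mathlib

section
/- Let n ≥ 1, let Ω ⊆ ℝⁿ be open, let V : Ω → ℝ be measurable, let e ≤ 0 and λ ≥ 1 be real numbers, and set U_e := {x ∈ Ω : V(x) < e}. Let W be a (finite-dimensional) subspace of the space of smooth compactly supported functions on Ω such that for every nonzero u ∈ W the function x ↦ |u(x)|²·V(x) is Lebesgue-integrable on Ω and ∫_Ω ‖∇u‖² dx + ∫_Ω |u|²·V dx < e·∫_Ω |u|² dx. Then (i) the linear map sending u ∈ W to its restriction u|_{U_e} is injective, and (ii) every nonzero u ∈ W satisfies ∫_{U_e} ‖∇u‖² dx < λ·∫_{U_e} |u|²·(V − e)_- dx. -/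
open MeasureTheory

/-- The part of `∫ f * g` over the region where `g` is positive dominates the whole integral. -/
theorem setIntegral_mul_le_setIntegral_mul_posPart {α : Type*} [MeasurableSpace α]
    {μ : Measure α} {s t : Set α} (hs : MeasurableSet s) (hts : t ⊆ s) {f g : α → ℝ}
    (hf : ∀ x, 0 ≤ f x) (hg : ∀ x ∈ s \ t, g x ≤ 0)
    (hfg : IntegrableOn (fun x => f x * g x) s μ) :
    ∫ x in s, f x * g x ∂μ ≤ ∫ x in t, f x * max (g x) 0 ∂μ := by
  have hpos : IntegrableOn (fun x => f x * max (g x) 0) s μ := by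
    refine hfg.pos_part.congr (.of_forall fun x => ?_)
    simp only [mul_max_of_nonneg _ _ (hf x), mul_zero]
  calc ∫ x in s, f x * g x ∂μ
      ≤ ∫ x in s, f x * max (g x) 0 ∂μ :=
        setIntegral_mono hfg hpos fun x => mul_le_mul_of_nonneg_left (le_max_left _ _) (hf x)
    _ = ∫ x in t, f x * max (g x) 0 ∂μ :=
        setIntegral_eq_of_subset_of_forall_sdiff_eq_zero (f := fun x => f x * max (g x) 0) hs hts
          (fun x hx => by simp [hg x hx])

/-- If the Schrödinger form of `u` is below `e` times its `L²` norm, then the Dirichlet integral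
of `u` over `{V < e}` is below its `L²` norm for the weight `(V - e)₋`. -/
theorem setIntegral_fderiv_sq_lt_of_form_lt {E : Type*} [NormedAddCommGroup E]
    [NormedSpace ℝ E] [MeasurableSpace E] [BorelSpace E] {μ : Measure E}
    [IsFiniteMeasureOnCompacts μ] {Ω : Set E} (hΩ : MeasurableSet Ω) {V u : E → ℝ} {e : ℝ}
    (hu : ContDiff ℝ 1 u) (hsupp : HasCompactSupport u)
    (hint : IntegrableOn (fun x => (u x) ^ 2 * V x) Ω μ)
    (hform : (∫ x in Ω, ‖fderiv ℝ u x‖ ^ 2 ∂μ) + (∫ x in Ω, (u x) ^ 2 * V x ∂μ)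
      < e * ∫ x in Ω, (u x) ^ 2 ∂μ) :
    (∫ x in {x ∈ Ω | V x < e}, ‖fderiv ℝ u x‖ ^ 2 ∂μ)
      < ∫ x in {x ∈ Ω | V x < e}, (u x) ^ 2 * max (e - V x) 0 ∂μ := by
  have hgrad : Integrable (fun x => ‖fderiv ℝ u x‖ ^ 2) μ := by
    have hc : HasCompactSupport fun x => ‖fderiv ℝ u x‖ ^ 2 :=
      HasCompactSupport.comp_left (g := fun L : E →L[ℝ] ℝ => ‖L‖ ^ 2)
        (hsupp.fderiv (𝕜 := ℝ)) (by simp)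
    exact ((hu.continuous_fderiv one_ne_zero).norm.pow 2).integrable_of_hasCompactSupport hc
  have hsq : Integrable (fun x => (u x) ^ 2) μ := by
    have hc : HasCompactSupport fun x => (u x) ^ 2 :=
      hsupp.comp_left (g := fun y : ℝ => y ^ 2) (by simp)
    exact (hu.continuous.pow 2).integrable_of_hasCompactSupport hc
  have hshift : (fun x => (u x) ^ 2 * (e - V x)) = fun x => e * (u x) ^ 2 - (u x) ^ 2 * V x := by
    ext x; ring
  have hmul : IntegrableOn (fun x => (u x) ^ 2 * (e - V x)) Ω μ := by
    rw [hshift]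
    exact (hsq.integrableOn.const_mul e).sub hint
  have hsplit : ∫ x in Ω, (u x) ^ 2 * (e - V x) ∂μ
      = e * (∫ x in Ω, (u x) ^ 2 ∂μ) - ∫ x in Ω, (u x) ^ 2 * V x ∂μ := by
    rw [hshift, integral_sub (hsq.integrableOn.const_mul e) hint, integral_const_mul]
  calc (∫ x in {x ∈ Ω | V x < e}, ‖fderiv ℝ u x‖ ^ 2 ∂μ)
      ≤ ∫ x in Ω, ‖fderiv ℝ u x‖ ^ 2 ∂μ :=
        setIntegral_mono_set hgrad.integrableOn (.of_forall fun x => by positivity)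
          (Set.sep_subset _ _).eventuallyLE
    _ < ∫ x in Ω, (u x) ^ 2 * (e - V x) ∂μ := by rw [hsplit]; linarith
    _ ≤ _ := setIntegral_mul_le_setIntegral_mul_posPart hΩ (Set.sep_subset _ _)
        (fun x => sq_nonneg (u x))
        (fun x hx => by
          have : e ≤ V x := not_lt.mp fun h => hx.2 ⟨hx.1, h⟩
          linarith) hmul

/-- The min–max core of Lemma 2.2: a finite-dimensional subspace `W` of smooth
compactly supported functions on which the Schrödinger form is below `e` times
the `L²` norm injects by restriction into `U_e = {V < e}`, and on it the
Dirichlet integral over `U_e` is below `λ` times the `L²(m_e)` norm,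
`m_e = (V - e)₋ dx`. -/
theorem schroedinger_counting_subspace
    (n : ℕ) (hn : 1 ≤ n)
    (Ω : Set (EuclideanSpace ℝ (Fin n))) (hΩ : IsOpen Ω)
    (V : EuclideanSpace ℝ (Fin n) → ℝ) (hV : Measurable V)
    (e lam : ℝ) (he : e ≤ 0) (hlam : 1 ≤ lam)
    (W : Submodule ℝ (EuclideanSpace ℝ (Fin n) → ℝ))
    (hfin : FiniteDimensional ℝ W)
    (hsmooth : ∀ u ∈ W, ContDiff ℝ (⊤ : ℕ∞) u ∧ HasCompactSupport u ∧ tsupport u ⊆ Ω)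
    (hform : ∀ u ∈ W, u ≠ 0 →
      IntegrableOn (fun x => (u x) ^ 2 * V x) Ω ∧
      (∫ x in Ω, ‖fderiv ℝ u x‖ ^ 2) + (∫ x in Ω, (u x) ^ 2 * V x)
        < e * ∫ x in Ω, (u x) ^ 2) :
    (∀ u ∈ W, ∀ v ∈ W, Set.EqOn u v {x ∈ Ω | V x < e} → u = v) ∧
    (∀ u ∈ W, u ≠ 0 →
      (∫ x in {x ∈ Ω | V x < e}, ‖fderiv ℝ u x‖ ^ 2)
        < lam * ∫ x in {x ∈ Ω | V x < e}, (u x) ^ 2 * max (e - V x) 0) := by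
  have key : ∀ u ∈ W, u ≠ 0 →
      (∫ x in {x ∈ Ω | V x < e}, ‖fderiv ℝ u x‖ ^ 2)
        < ∫ x in {x ∈ Ω | V x < e}, (u x) ^ 2 * max (e - V x) 0 := fun u hu hne =>
    setIntegral_fderiv_sq_lt_of_form_lt hΩ.measurableSet
      ((hsmooth u hu).1.of_le (by exact_mod_cast le_top)) (hsmooth u hu).2.1
      (hform u hu hne).1 (hform u hu hne).2
  refine ⟨fun u hu v hv huv => ?_, fun u hu hne => (key u hu hne).trans_le ?_⟩
  · by_contra hne
    have hlt := key (u - v) (W.sub_mem hu hv) (sub_ne_zero.mpr hne)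
    rw [setIntegral_eq_zero_of_forall_eq_zero (f := fun x => ((u - v) x) ^ 2 * max (e - V x) 0)
      fun x hx => by simp [huv hx]] at hlt
    exact hlt.not_ge (integral_nonneg fun x => by positivity)
  · exact le_mul_of_one_le_left (integral_nonneg fun x => by positivity) hlam
end

section
/- Let H be a real Hilbert space, let B : H × H → ℝ be a continuous symmetric bilinear form, and let H₀ ⊆ H be a closed subspace such that there exists a continuous linear equivalence T : H₀ ≃ H₀ with B(u, v) = ⟨T u, v⟩ for all u, v ∈ H₀. Set H₁ := {u ∈ H : B(w, u) = 0 for all w ∈ H₀}. Call a subspace W B-negative-definite if B(u, u) < 0 for every nonzero u ∈ W. Let n₀, n₁ ∈ ℕ and assume: every B-negative-definite subspace of H₀ has dimension ≤ n₀ and there exists one of dimension n₀; likewise for H₁ with n₁. Then every B-negative-definite subspace of H has dimension ≤ n₀ + n₁, and there exists a B-negative-definite subspace of H of dimension exactly n₀ + n₁. -/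
open scoped RealInnerProductSpace

section NegativeDefinite

variable {E : Type*} [AddCommGroup E] [Module ℝ E] {B : LinearMap.BilinForm ℝ E}

/-- The symmetric form `B` is negative definite on the subspace `W`. -/
def NegDefOn (B : LinearMap.BilinForm ℝ E) (W : Submodule ℝ E) : Prop :=
  ∀ u ∈ W, u ≠ 0 → B u u < 0

lemma NegDefOn.apply_self_nonpos {W : Submodule ℝ E} (hW : NegDefOn B W) {u : E} (hu : u ∈ W) :
    B u u ≤ 0 := by
  rcases eq_or_ne u 0 with rfl | h
  · simp
  · exact (hW u hu h).le

lemma apply_add_self_of_ortho (hB : B.IsSymm) {u v : E} (h : B u v = 0) :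
    B (u + v) (u + v) = B u u + B v v := by
  have h' : B v u = 0 := (hB.eq u v).symm.trans h
  simp [h, h']

lemma NegDefOn.sup (hB : B.IsSymm) {W₀ W₁ : Submodule ℝ E} (h₀ : NegDefOn B W₀)
    (h₁ : NegDefOn B W₁) (ho : ∀ u ∈ W₀, ∀ v ∈ W₁, B u v = 0) : NegDefOn B (W₀ ⊔ W₁) := by
  intro u hu hne
  obtain ⟨x, hx, y, hy, rfl⟩ := Submodule.mem_sup.1 hu
  rw [apply_add_self_of_ortho hB (ho x hx y hy)]
  rcases eq_or_ne x 0 with rfl | hx0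
  · simpa using h₁ y hy (by simpa using hne)
  · linarith [h₀ x hx hx0, h₁.apply_self_nonpos hy]

lemma NegDefOn.rank_sup {W₀ W₁ : Submodule ℝ E} (h₀ : NegDefOn B W₀)
    (ho : ∀ u ∈ W₀, ∀ v ∈ W₁, B u v = 0) :
    Module.rank ℝ (W₀ ⊔ W₁ : Submodule ℝ E) = Module.rank ℝ W₀ + Module.rank ℝ W₁ := by
  have hinf : W₀ ⊓ W₁ = ⊥ := by
    refine (Submodule.eq_bot_iff _).2 fun x hx => ?_
    by_contra hne
    exact (h₀ x hx.1 hne).ne (ho x hx.1 x hx.2)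
  rw [← Submodule.rank_sup_add_rank_inf_eq, hinf, rank_bot, add_zero]

/-- A symmetric form is nonnegative on the orthogonal complement, inside `V`, of a negative
definite subspace of `V` of maximal dimension. -/
lemma NegDefOn.apply_self_nonneg_of_maximal (hB : B.IsSymm) {V W : Submodule ℝ E} {n : ℕ}
    (hmax : ∀ W' ≤ V, NegDefOn B W' → Module.rank ℝ W' ≤ n)
    (hWV : W ≤ V) (hW : NegDefOn B W) (hrank : Module.rank ℝ W = n)
    {u : E} (hu : u ∈ V) (ho : ∀ w ∈ W, B w u = 0) : 0 ≤ B u u := by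
  by_contra! hneg
  have hu0 : u ≠ 0 := by rintro rfl; simp at hneg
  have ho' : ∀ w ∈ W, ∀ v ∈ ℝ ∙ u, B w v = 0 := by
    intro w hw v hv
    obtain ⟨c, rfl⟩ := Submodule.mem_span_singleton.1 hv
    simp [ho w hw]
  have hspan : NegDefOn B (ℝ ∙ u) := by
    intro v hv hv0
    obtain ⟨c, rfl⟩ := Submodule.mem_span_singleton.1 hv
    have hc : c ≠ 0 := by rintro rfl; simp at hv0
    have : B (c • u) (c • u) = c ^ 2 * B u u := by simp; ring
    rw [this]
    exact mul_neg_of_pos_of_neg (by positivity) hneg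
  have hle := hmax (W ⊔ ℝ ∙ u)
    (sup_le hWV ((Submodule.span_singleton_le_iff_mem u V).2 hu)) (hW.sup hB hspan ho')
  rw [hW.rank_sup ho', hrank, ← Module.finrank_eq_rank ℝ (ℝ ∙ u),
    finrank_span_singleton hu0] at hle
  norm_cast at hle
  omega

/-- If a form is nonnegative on the orthogonal complement of a finite-dimensional subspace `N`,
then the negative definite subspaces have dimension at most that of `N`. -/
lemma NegDefOn.rank_le_of_nonneg_ortho {N W : Submodule ℝ E} {n : ℕ}
    (hN : Module.rank ℝ N = n) (hpos : ∀ u, (∀ w ∈ N, B u w = 0) → 0 ≤ B u u)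
    (hW : NegDefOn B W) : Module.rank ℝ W ≤ n := by
  have : FiniteDimensional ℝ N :=
    Module.rank_lt_aleph0_iff.1 (hN ▸ Cardinal.natCast_lt_aleph0)
  let f : W →ₗ[ℝ] Module.Dual ℝ N := (B.compl₂ N.subtype).domRestrict W
  have hf : Function.Injective f := by
    refine (injective_iff_map_eq_zero f).2 fun w hw => ?_
    by_contra hne
    exact (hW w w.2 (by simpa using hne)).not_ge
      (hpos w fun v hv => LinearMap.congr_fun hw ⟨v, hv⟩)
  have hdual : Module.rank ℝ (Module.Dual ℝ N) = n := by
    rw [← Module.finrank_eq_rank, Subspace.dual_finrank_eq, Module.finrank_eq_rank, hN]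
  have := LinearMap.lift_rank_le_of_injective f hf
  rw [hdual] at this
  simpa using this

end NegativeDefinite

/-- If `B` is represented on `H₀` by an invertible operator, then every vector is the sum of a
vector of `H₀` and a vector `B`-orthogonal to `H₀`. -/
lemma exists_sub_ortho_of_represented
    {H : Type*} [NormedAddCommGroup H] [InnerProductSpace ℝ H]
    (B : H →L[ℝ] H →L[ℝ] ℝ) (hsymm : ∀ u v : H, B u v = B v u)
    (H₀ : Submodule ℝ H) [CompleteSpace H₀] (T : H₀ ≃L[ℝ] H₀)
    (hT : ∀ u v : H₀, B u v = ⟪(T u : H₀), v⟫) (u : H) :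
    ∃ x ∈ H₀, ∀ w ∈ H₀, B w (u - x) = 0 := by
  let f : H₀ := (InnerProductSpace.toDual ℝ H₀).symm ((B u).comp H₀.subtypeL)
  refine ⟨T.symm f, (T.symm f).2, fun w hw => ?_⟩
  have h := hT (T.symm f) ⟨w, hw⟩
  rw [T.apply_symm_apply, InnerProductSpace.toDual_symm_apply] at h
  rw [hsymm, map_sub, sub_apply, sub_eq_zero]
  exact h.symm

/-- The abstract form of the main splitting (4.1) of Theorem 4.1: if the
restriction of a continuous symmetric bilinear form `B` to a closed subspace
`H₀` is represented by a bounded invertible operator on `H₀`, and `H₁` is the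
`B`-orthogonal complement of `H₀`, then the maximal dimension of a
`B`-negative-definite subspace of `H` equals the sum of the maximal dimensions
of `B`-negative-definite subspaces of `H₀` and of `H₁`. -/
theorem negative_index_splitting
    {H : Type*} [NormedAddCommGroup H] [InnerProductSpace ℝ H] [CompleteSpace H]
    (B : H →L[ℝ] H →L[ℝ] ℝ) (hsymm : ∀ u v : H, B u v = B v u)
    (H₀ : Submodule ℝ H) (hclosed : IsClosed (H₀ : Set H))
    (T : H₀ ≃L[ℝ] H₀)
    (hT : ∀ u v : H₀, B u v = ⟪(T u : H₀), v⟫)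
    (n₀ n₁ : ℕ)
    (h₀max : ∀ W : Submodule ℝ H, W ≤ H₀ → (∀ u ∈ W, u ≠ 0 → B u u < 0) →
      Module.rank ℝ W ≤ (n₀ : Cardinal))
    (h₀ex : ∃ W : Submodule ℝ H, W ≤ H₀ ∧ (∀ u ∈ W, u ≠ 0 → B u u < 0) ∧
      Module.rank ℝ W = (n₀ : Cardinal))
    (h₁max : ∀ W : Submodule ℝ H,
      (W : Set H) ⊆ {u : H | ∀ w ∈ H₀, B w u = 0} →
      (∀ u ∈ W, u ≠ 0 → B u u < 0) → Module.rank ℝ W ≤ (n₁ : Cardinal))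
    (h₁ex : ∃ W : Submodule ℝ H,
      (W : Set H) ⊆ {u : H | ∀ w ∈ H₀, B w u = 0} ∧
      (∀ u ∈ W, u ≠ 0 → B u u < 0) ∧ Module.rank ℝ W = (n₁ : Cardinal)) :
    (∀ W : Submodule ℝ H, (∀ u ∈ W, u ≠ 0 → B u u < 0) →
      Module.rank ℝ W ≤ ((n₀ + n₁ : ℕ) : Cardinal)) ∧
    (∃ W : Submodule ℝ H, (∀ u ∈ W, u ≠ 0 → B u u < 0) ∧
      Module.rank ℝ W = ((n₀ + n₁ : ℕ) : Cardinal)) := by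
  have : CompleteSpace H₀ := hclosed.completeSpace_coe
  let b : LinearMap.BilinForm ℝ H := B.toLinearMap₁₂
  have hb : b.IsSymm := ⟨fun u v => hsymm u v⟩
  let H₁ : Submodule ℝ H := H₀.orthogonalBilin b
  obtain ⟨W₀, hW₀, hneg₀, hrank₀⟩ := h₀ex
  obtain ⟨W₁, hW₁, hneg₁, hrank₁⟩ := h₁ex
  replace hneg₀ : NegDefOn b W₀ := hneg₀
  replace hneg₁ : NegDefOn b W₁ := hneg₁
  have ho : ∀ u ∈ W₀, ∀ v ∈ W₁, b u v = 0 := fun u hu v hv => hW₁ hv u (hW₀ hu)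
  have hrank : Module.rank ℝ (W₀ ⊔ W₁ : Submodule ℝ H) = ((n₀ + n₁ : ℕ) : Cardinal) := by
    rw [hneg₀.rank_sup ho, hrank₀, hrank₁, Nat.cast_add]
  refine ⟨fun W hW => NegDefOn.rank_le_of_nonneg_ortho (B := b) hrank (fun u hu => ?_) hW,
    W₀ ⊔ W₁, hneg₀.sup hb hneg₁ ho, hrank⟩
  obtain ⟨x, hx, hy⟩ := exists_sub_ortho_of_represented B hsymm H₀ T hT u
  obtain ⟨y, rfl⟩ : ∃ y, u = x + y := ⟨u - x, by abel⟩
  rw [add_sub_cancel_left] at hy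
  have hx₀ : 0 ≤ b x x := by
    refine hneg₀.apply_self_nonneg_of_maximal hb h₀max hW₀ hrank₀ hx fun w hw => ?_
    have h₁ : b (x + y) w = 0 := hu w (Submodule.mem_sup_left hw)
    have h₂ : b w y = 0 := hy w (hW₀ hw)
    rw [← hb.eq] at h₁
    simpa [h₂] using h₁
  have hy₁ : 0 ≤ b y y := by
    refine hneg₁.apply_self_nonneg_of_maximal (V := H₁) hb h₁max hW₁ hrank₁ hy fun w hw => ?_
    have h₁ : b (x + y) w = 0 := hu w (Submodule.mem_sup_right hw)
    have h₂ : b x w = 0 := hW₁ hw x hx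
    rw [← hb.eq]
    simpa [h₂] using h₁
  rw [apply_add_self_of_ortho hb (hy x hx)]
  exact add_nonneg hx₀ hy₁
end

section
/- Let n ≥ 3, let U ⊆ ℝⁿ be open, let p ∈ (n/2, ∞), set n* := 2n/(n − 2) and r := n*·(1 − 1/p), and let S_n := (n(n − 2)π)^{-1}·(Γ(n)/Γ(n/2))^{2/n}. Let w : U → [0, ∞) be measurable with ∫_U w^p dx < ∞. Then for every smooth compactly supported function u : ℝⁿ → ℝ with support contained in U, (∫_U |u|^r · w dx)^{2/r} ≤ S_n · (∫_U w^p dx)^{2/(rp)} · ∫_U ‖∇u‖² dx. -/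
open MeasureTheory

section

open Set Filter Topology

/-- The closed cube `[-L, L]^k`. -/
def cube (k : ℕ) (L : ℝ) : Set (Fin k → ℝ) := Icc (fun _ => -L) (fun _ => L)

lemma isCompact_cube (k : ℕ) (L : ℝ) : IsCompact (cube k L) := isCompact_Icc

lemma measurableSet_cube (k : ℕ) (L : ℝ) : MeasurableSet (cube k L) := measurableSet_Icc

lemma mem_cube {k : ℕ} {L : ℝ} {x : Fin k → ℝ} : x ∈ cube k L ↔ ∀ i, x i ∈ Icc (-L) L := by
  simp only [cube, mem_Icc, Pi.le_def, forall_and]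

lemma integrableOn_cube {k : ℕ} {L : ℝ} {f : (Fin k → ℝ) → ℝ} (hf : Continuous f) :
    IntegrableOn f (cube k L) :=
  hf.continuousOn.integrableOn_compact (isCompact_cube k L)

lemma continuous_integral_cube {P : Type*} [TopologicalSpace P] [FirstCountableTopology P]
    [LocallyCompactSpace P] {k : ℕ} {L : ℝ} {f : P → (Fin k → ℝ) → ℝ}
    (hf : Continuous fun q : P × (Fin k → ℝ) => f q.1 q.2) :
    Continuous fun s => ∫ x in cube k L, f s x :=
  continuous_parametric_integral_of_continuous hf (isCompact_cube k L)

/-- Fubini's theorem on a cube, singling out the `i`-th coordinate. -/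
lemma integral_cube_succ {k : ℕ} {L : ℝ} (hL : 0 ≤ L) (i : Fin (k + 1))
    {f : (Fin (k + 1) → ℝ) → ℝ} (hf : Continuous f) :
    ∫ x in cube (k + 1) L, f x
      = ∫ t in -L..L, ∫ y in cube k L, f (i.insertNth (α := fun _ => ℝ) t y) := by
  have hmp := (volume_preserving_piFinSuccAbove (fun _ : Fin (k + 1) => ℝ) i).symm
  have hpre : (MeasurableEquiv.piFinSuccAbove (fun _ : Fin (k + 1) => ℝ) i).symm ⁻¹'
      (cube (k + 1) L) = Icc (-L) L ×ˢ cube k L := by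
    ext ⟨t, y⟩
    simp only [mem_preimage, mem_cube, mem_prod, MeasurableEquiv.piFinSuccAbove_symm_apply,
      Fin.insertNthEquiv, Equiv.coe_fn_mk]
    rw [Fin.forall_iff_succAbove i]
    simp
  have hc : Continuous fun q : ℝ × (Fin k → ℝ) => f (i.insertNth (α := fun _ => ℝ) q.1 q.2) :=
    hf.comp (Continuous.finInsertNth (A := fun _ => ℝ) i continuous_fst continuous_snd)
  rw [← hmp.setIntegral_preimage_emb (MeasurableEquiv.measurableEmbedding _), hpre,
    Measure.volume_eq_prod, setIntegral_prod, intervalIntegral.integral_of_le (by linarith),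
    integral_Icc_eq_integral_Ioc]
  · rfl
  · exact hc.continuousOn.integrableOn_compact (isCompact_Icc.prod (isCompact_cube k L))

/-- The fundamental theorem of calculus in the `i`-th coordinate, integrated over a cube. -/
lemma integral_cube_deriv {k : ℕ} {L : ℝ} (hL : 0 ≤ L) (i : Fin (k + 1))
    {g D : (Fin (k + 1) → ℝ) → ℝ} (hD : Continuous D)
    (hg : ∀ x, HasDerivAt (fun t => g (Function.update x i t)) (D x) (x i)) :
    ∫ x in cube (k + 1) L, D x = ∫ y in cube k L,
      (g (i.insertNth (α := fun _ => ℝ) L y) - g (i.insertNth (α := fun _ => ℝ) (-L) y)) := by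
  have hc : Continuous fun q : ℝ × (Fin k → ℝ) => D (i.insertNth (α := fun _ => ℝ) q.1 q.2) :=
    hD.comp (Continuous.finInsertNth (A := fun _ => ℝ) i continuous_fst continuous_snd)
  rw [integral_cube_succ hL i hD]
  rw [intervalIntegral.integral_of_le (by linarith), ← integral_Icc_eq_integral_Ioc,
    integral_integral_swap]
  · congr 1 with y
    rw [integral_Icc_eq_integral_Ioc, ← intervalIntegral.integral_of_le (by linarith)]
    rw [intervalIntegral.integral_eq_sub_of_hasDerivAt
      (f := fun t => g (i.insertNth (α := fun _ => ℝ) t y))]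
    · intro t _
      have := hg (i.insertNth (α := fun _ => ℝ) t y)
      simpa using this
    · exact (hc.comp (Continuous.prodMk_left y)).intervalIntegrable _ _
  · rw [Measure.prod_restrict, ← Measure.volume_eq_prod]
    exact hc.continuousOn.integrableOn_compact (isCompact_Icc.prod (isCompact_cube k L))

/-- Monotone rearrangement on the line, with a parameter. -/
lemma exists_monotone_transport {P : Type*} [TopologicalSpace P] {L : ℝ} {F G : P → ℝ → ℝ}
    (hF : Continuous fun q : P × ℝ => F q.1 q.2) (hG : Continuous fun q : P × ℝ => G q.1 q.2)
    (hFpos : ∀ s x, 0 < F s x) {m : ℝ} (hm : 0 < m) (hGm : ∀ s x, m ≤ G s x)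
    (hFG : ∀ s, ∫ x in -L..L, F s x = ∫ x in -L..L, G s x) :
    ∃ T d : P → ℝ → ℝ, Continuous (fun q : P × ℝ => T q.1 q.2) ∧
      Continuous (fun q : P × ℝ => d q.1 q.2) ∧
      (∀ s x, HasDerivAt (T s) (d s x) x) ∧ (∀ s x, 0 < d s x) ∧
      (∀ s x, F s x = G s (T s x) * d s x) ∧ (∀ s, T s (-L) = -L) ∧ (∀ s, T s L = L) := by
  have hFc : ∀ s, Continuous (F s) := fun s => hF.comp (Continuous.prodMk_right s)
  have hGc : ∀ s, Continuous (G s) := fun s => hG.comp (Continuous.prodMk_right s)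
  set Φ : P → ℝ → ℝ := fun s x => ∫ t in -L..x, F s t with hΦ
  set Ψ : P → ℝ → ℝ := fun s x => ∫ t in -L..x, G s t with hΨ
  have hΦc : Continuous fun q : P × ℝ => Φ q.1 q.2 :=
    intervalIntegral.continuous_parametric_primitive_of_continuous hF
  have hΨc : Continuous fun q : P × ℝ => Ψ q.1 q.2 :=
    intervalIntegral.continuous_parametric_primitive_of_continuous hG
  have hΦd : ∀ s x, HasDerivAt (Φ s) (F s x) x := fun s x =>
    (hFc s).integral_hasStrictDerivAt _ _ |>.hasDerivAt
  have hΨd : ∀ s x, HasDerivAt (Ψ s) (G s x) x := fun s x =>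
    (hGc s).integral_hasStrictDerivAt _ _ |>.hasDerivAt
  have hinc : ∀ s a b, a ≤ b → m * (b - a) ≤ Ψ s b - Ψ s a := by
    intro s a b hab
    rw [hΨ]
    simp only
    rw [intervalIntegral.integral_interval_sub_left ((hGc s).intervalIntegrable _ _)
      ((hGc s).intervalIntegrable _ _)]
    calc m * (b - a) = ∫ _ in a..b, m := by simp [mul_comm]
      _ ≤ _ := intervalIntegral.integral_mono_on hab (by simp) ((hGc s).intervalIntegrable _ _)
        (fun x _ => hGm s x)
  have habs : ∀ s a b, m * |b - a| ≤ |Ψ s b - Ψ s a| := by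
    intro s a b
    rcases le_total a b with h | h
    · rw [abs_of_nonneg (sub_nonneg.2 h)]
      exact (hinc s a b h).trans (le_abs_self _)
    · rw [abs_sub_comm, abs_of_nonneg (sub_nonneg.2 h), abs_sub_comm]
      exact (hinc s b a h).trans (le_abs_self _)
  have hinj : ∀ s, Function.Injective (Ψ s) := by
    intro s a b hab
    have h := habs s a b
    rw [hab, sub_self, abs_zero] at h
    have h1 : |b - a| ≤ 0 := by
      by_contra! hc
      nlinarith
    have := abs_nonpos_iff.1 h1
    linarith
  have hsurj : ∀ s, Function.Surjective (Ψ s) := by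
    intro s
    have hz : Ψ s (-L) = 0 := by simp [hΨ]
    apply Continuous.surjective (hΨc.comp (Continuous.prodMk_right s))
    · apply tendsto_atTop_mono' atTop (f₁ := fun x => m * (x - (-L)))
      · filter_upwards [eventually_ge_atTop (-L)] with x hx
        have := hinc s (-L) x hx
        simp only [Function.comp]
        linarith
      · exact (tendsto_atTop_add_const_right _ _ tendsto_id).const_mul_atTop hm
    · apply tendsto_atBot_mono' atBot (f₁ := fun x => m * (x - (-L)))
      · filter_upwards [eventually_le_atBot (-L)] with x hx
        have := hinc s x (-L) hx
        simp only [Function.comp]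
        linarith
      · exact (tendsto_atBot_add_const_right _ _ tendsto_id).const_mul_atBot hm
  choose Ψi hΨi using hsurj
  set T : P → ℝ → ℝ := fun s x => Ψi s (Φ s x) with hT
  have hΨT : ∀ s x, Ψ s (T s x) = Φ s x := fun s x => hΨi s _
  have hTc : Continuous fun q : P × ℝ => T q.1 q.2 := by
    rw [continuous_iff_continuousAt]
    rintro ⟨s₀, x₀⟩
    rw [ContinuousAt, tendsto_iff_dist_tendsto_zero]
    have h1 : Tendsto (fun q : P × ℝ => |Φ q.1 q.2 - Ψ q.1 (T s₀ x₀)| / m) (𝓝 (s₀, x₀)) (𝓝 0) := by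
      have hc : Continuous fun q : P × ℝ => |Φ q.1 q.2 - Ψ q.1 (T s₀ x₀)| / m :=
        ((hΦc.sub (hΨc.comp (continuous_fst.prodMk continuous_const))).abs).div_const m
      have := hc.tendsto (s₀, x₀)
      simpa [hΨT] using this
    refine squeeze_zero (fun _ => dist_nonneg) (fun q => ?_) h1
    rw [le_div_iff₀ hm, mul_comm, ← hΨT q.1 q.2]
    exact habs _ _ _
  have hΨic : ∀ s y, ContinuousAt (Ψi s) y := by
    intro s y
    rw [ContinuousAt, tendsto_iff_dist_tendsto_zero]
    have h1 : Tendsto (fun z => |z - y| / m) (𝓝 y) (𝓝 0) := by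
      have hc : Continuous fun z : ℝ => |z - y| / m := by fun_prop
      simpa using hc.tendsto y
    refine squeeze_zero (fun _ => dist_nonneg) (fun z => ?_) h1
    rw [le_div_iff₀ hm, mul_comm]
    simpa only [hΨi, Real.dist_eq] using habs s (Ψi s y) (Ψi s z)
  have hGpos : ∀ s x, 0 < G s x := fun s x => hm.trans_le (hGm s x)
  refine ⟨T, fun s x => F s x / G s (T s x), hTc, ?_, ?_, ?_, ?_, ?_, ?_⟩
  · exact hF.div (hG.comp (continuous_fst.prodMk hTc)) fun q => (hGpos _ _).ne'
  · intro s x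
    have h1 : HasDerivAt (Ψi s) (G s (T s x))⁻¹ (Φ s x) :=
      HasDerivAt.of_local_left_inverse (hΨic s _) (hΨd s _) (hGpos _ _).ne'
        (Eventually.of_forall fun y => hΨi s y)
    have := h1.comp x (hΦd s x)
    rwa [inv_mul_eq_div] at this
  · exact fun s x => div_pos (hFpos _ _) (hGpos _ _)
  · intro s x
    rw [mul_div_cancel₀ _ (hGpos _ _).ne']
  · intro s
    apply hinj s
    rw [hΨT]
    simp [hΦ, hΨ]
  · intro s
    apply hinj s
    rw [hΨT]
    exact hFG s

lemma volume_real_cube (k : ℕ) {L : ℝ} (hL : 0 ≤ L) :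
    (volume : Measure (Fin k → ℝ)).real (cube k L) = (2 * L) ^ k := by
  rw [cube, Measure.real, Real.volume_Icc_pi_toReal (by intro i; simpa using by linarith)]
  simp [two_mul]

lemma le_integral_cube {k : ℕ} {L : ℝ} (hL : 0 ≤ L) {f : (Fin k → ℝ) → ℝ} (hf : Continuous f)
    {m : ℝ} (hm : ∀ x ∈ cube k L, m ≤ f x) : m * (2 * L) ^ k ≤ ∫ x in cube k L, f x := by
  have := setIntegral_mono_on (μ := volume) (s := cube k L) (f := fun _ => m) (g := f)
    (integrableOn_cube continuous_const) (integrableOn_cube hf) (measurableSet_cube k L) hm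
  rwa [setIntegral_const, volume_real_cube k hL, smul_eq_mul, mul_comm] at this

lemma integral_cube_le {k : ℕ} {L : ℝ} (hL : 0 ≤ L) {f : (Fin k → ℝ) → ℝ} (hf : Continuous f)
    {M : ℝ} (hM : ∀ x ∈ cube k L, f x ≤ M) : ∫ x in cube k L, f x ≤ M * (2 * L) ^ k := by
  have := setIntegral_mono_on (μ := volume) (s := cube k L) (f := f) (g := fun _ => M)
    (integrableOn_cube hf) (integrableOn_cube continuous_const) (measurableSet_cube k L) hM
  rwa [setIntegral_const, volume_real_cube k hL, smul_eq_mul, mul_comm] at this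

lemma integral_cube_pos {k : ℕ} {L : ℝ} (hL : 0 < L) {f : (Fin k → ℝ) → ℝ} (hf : Continuous f)
    (hpos : ∀ x, 0 < f x) : 0 < ∫ x in cube k L, f x := by
  have hne : (cube k L).Nonempty := ⟨0, mem_cube.2 fun i => by simp [hL.le]⟩
  obtain ⟨x₀, -, h⟩ := (isCompact_cube k L).exists_isMinOn hne hf.continuousOn
  have h1 := le_integral_cube hL.le hf (fun x hx => h hx)
  have h2 := hpos x₀
  have : 0 < f x₀ * (2 * L) ^ k := by positivity
  linarith

lemma integral_cube_vecCons {k : ℕ} {L : ℝ} (hL : 0 ≤ L) {f : (Fin (k + 1) → ℝ) → ℝ}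
    (hf : Continuous f) :
    ∫ x in cube (k + 1) L, f x = ∫ t in -L..L, ∫ y in cube k L, f (Matrix.vecCons t y) := by
  rw [integral_cube_succ hL 0 hf]
  simp only [Fin.insertNth_zero']
  rfl

/-- The Knothe transport between two families of densities on a cube: a triangular map whose
diagonal derivatives `d` multiply up to the Jacobian. -/
theorem exists_knothe_transport {L : ℝ} (hL : 0 < L) (k : ℕ) :
    ∀ {P : Type} [TopologicalSpace P] [FirstCountableTopology P] [LocallyCompactSpace P]
      {F G : P → (Fin k → ℝ) → ℝ} (_ : Continuous fun q : P × (Fin k → ℝ) => F q.1 q.2)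
      (_ : Continuous fun q : P × (Fin k → ℝ) => G q.1 q.2) (_ : ∀ s x, 0 < F s x)
      {m M : ℝ} (_ : 0 < m) (_ : ∀ s x, m ≤ G s x) (_ : ∀ s x, G s x ≤ M)
      (_ : ∀ s, ∫ x in cube k L, F s x = ∫ x in cube k L, G s x),
      ∃ T d : P → (Fin k → ℝ) → (Fin k → ℝ),
        Continuous (fun q : P × (Fin k → ℝ) => T q.1 q.2) ∧
        Continuous (fun q : P × (Fin k → ℝ) => d q.1 q.2) ∧
        (∀ s x i, HasDerivAt (fun t => T s (Function.update x i t) i) (d s x i) (x i)) ∧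
        (∀ s x i, 0 < d s x i) ∧
        (∀ s x, F s x = G s (T s x) * ∏ i, d s x i) ∧
        (∀ s, ∀ x ∈ cube k L, T s x ∈ cube k L) ∧
        (∀ s, ∀ φ : (Fin k → ℝ) → ℝ, Continuous φ →
          ∫ x in cube k L, φ (T s x) * F s x = ∫ y in cube k L, φ y * G s y) := by
  induction k with
  | zero =>
    intro P _ _ _ F G hF hG hFpos m M hm hGm hGM hFG
    have hFG' : ∀ s x, F s x = G s x := by
      intro s x
      have h := hFG s
      have h1 : ∀ f : (Fin 0 → ℝ) → ℝ, ∫ y in cube 0 L, f y = f x := by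
        intro f
        have : f = fun _ => f x := by ext y; rw [Subsingleton.elim y x]
        rw [this, setIntegral_const, volume_real_cube 0 hL.le]
        simp
      rwa [h1, h1] at h
    refine ⟨fun _ x => x, fun _ x => x, continuous_snd, continuous_snd, fun _ _ i => i.elim0,
      fun _ _ i => i.elim0, ?_, fun _ _ h => h, ?_⟩
    · intro s x
      simp [hFG']
    · intro s φ _
      simp only [hFG']
  | succ k ih =>
    intro P _ _ _ F G hF hG hFpos m M hm hGm hGM hFG
    set V : ℝ := (2 * L) ^ k with hV
    have hVpos : 0 < V := by positivity
    have hcons : ∀ (H : P → (Fin (k + 1) → ℝ) → ℝ),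
        Continuous (fun q : P × (Fin (k + 1) → ℝ) => H q.1 q.2) →
        Continuous fun q : (P × ℝ) × (Fin k → ℝ) => H q.1.1 (Matrix.vecCons q.1.2 q.2) := by
      intro H hH
      have : Continuous fun q : (P × ℝ) × (Fin k → ℝ) => (q.1.1, Matrix.vecCons q.1.2 q.2) := by
        fun_prop
      exact hH.comp this
    have hFc := hcons F hF
    have hGc := hcons G hG
    set F₀ : P → ℝ → ℝ := fun s t => ∫ y in cube k L, F s (Matrix.vecCons t y) with hF₀
    set G₀ : P → ℝ → ℝ := fun s t => ∫ y in cube k L, G s (Matrix.vecCons t y) with hG₀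
    have hF₀c : Continuous fun q : P × ℝ => F₀ q.1 q.2 := continuous_integral_cube hFc
    have hG₀c : Continuous fun q : P × ℝ => G₀ q.1 q.2 := continuous_integral_cube hGc
    have hF₀pos : ∀ s t, 0 < F₀ s t := fun s t =>
      integral_cube_pos hL (hFc.comp (Continuous.prodMk_right (s, t))) fun y => hFpos _ _
    have hG₀m : ∀ s t, m * V ≤ G₀ s t := fun s t =>
      le_integral_cube hL.le (hGc.comp (Continuous.prodMk_right (s, t))) fun y _ => hGm _ _
    have hG₀M : ∀ s t, G₀ s t ≤ M * V := fun s t =>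
      integral_cube_le hL.le (hGc.comp (Continuous.prodMk_right (s, t))) fun y _ => hGM _ _
    have hmV : 0 < m * V := mul_pos hm hVpos
    have hG₀pos : ∀ s t, 0 < G₀ s t := fun s t => hmV.trans_le (hG₀m s t)
    have hFs : ∀ s, Continuous (F s) := fun s => hF.comp (Continuous.prodMk_right s)
    have hGs : ∀ s, Continuous (G s) := fun s => hG.comp (Continuous.prodMk_right s)
    obtain ⟨T₀, d₀, hT₀c, hd₀c, hT₀d, hd₀pos, hT₀FG, hT₀l, hT₀r⟩ :=
      exists_monotone_transport (L := L) hF₀c hG₀c hF₀pos hmV hG₀m (by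
        intro s
        rw [← integral_cube_vecCons hL.le (hFs s), ← integral_cube_vecCons hL.le (hGs s), hFG])
    have hqT : Continuous fun q : P × ℝ => (q.1, T₀ q.1 q.2) := continuous_fst.prodMk hT₀c
    set F' : P × ℝ → (Fin k → ℝ) → ℝ := fun q y => F q.1 (Matrix.vecCons q.2 y) / F₀ q.1 q.2
      with hF'
    set G' : P × ℝ → (Fin k → ℝ) → ℝ := fun q y =>
      G q.1 (Matrix.vecCons (T₀ q.1 q.2) y) / G₀ q.1 (T₀ q.1 q.2) with hG'
    have hF'c : Continuous fun q : (P × ℝ) × (Fin k → ℝ) => F' q.1 q.2 :=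
      hFc.div (hF₀c.comp continuous_fst) fun q => (hF₀pos _ _).ne'
    have hG'c : Continuous fun q : (P × ℝ) × (Fin k → ℝ) => G' q.1 q.2 := by
      have h1 : Continuous fun q : (P × ℝ) × (Fin k → ℝ) => ((q.1.1, T₀ q.1.1 q.1.2), q.2) :=
        (hqT.comp continuous_fst).prodMk continuous_snd
      exact (hGc.comp h1).div (hG₀c.comp (hqT.comp continuous_fst)) fun q => (hG₀pos _ _).ne'
    obtain ⟨T', d', hT'c, hd'c, hT'd, hd'pos, hT'FG, hT'Q, hT'φ⟩ := ih hF'c hG'c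
      (fun q y => div_pos (hFpos _ _) (hF₀pos _ _)) (m := m / (|M * V| + 1)) (M := M / (m * V))
      (by positivity)
      (fun q y => div_le_div₀ (hm.le.trans (hGm q.1 (Matrix.vecCons (T₀ q.1 q.2) y))) (hGm _ _)
        (hG₀pos _ _) ((hG₀M _ _).trans ((le_abs_self _).trans (by linarith))))
      (fun q y => div_le_div₀ (hm.le.trans ((hGm q.1 0).trans (hGM q.1 0))) (hGM _ _) hmV
        (hG₀m _ _))
      (by
        intro q
        simp only [hF', hG', integral_div]
        rw [div_self (hF₀pos q.1 q.2).ne', div_self (hG₀pos q.1 (T₀ q.1 q.2)).ne'])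
    have hsplit : Continuous fun q : P × (Fin (k + 1) → ℝ) =>
        ((q.1, q.2 0), fun j : Fin k => q.2 j.succ) := by fun_prop
    have hsplit₀ : Continuous fun q : P × (Fin (k + 1) → ℝ) => (q.1, q.2 0) := by fun_prop
    set T : P → (Fin (k + 1) → ℝ) → (Fin (k + 1) → ℝ) := fun s x =>
      Matrix.vecCons (T₀ s (x 0)) (T' (s, x 0) fun j => x j.succ) with hT
    have hTc : Continuous fun q : P × (Fin (k + 1) → ℝ) => T q.1 q.2 :=
      Continuous.matrixVecCons (hT₀c.comp hsplit₀) (hT'c.comp hsplit)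
    refine ⟨T, fun s x => Matrix.vecCons (d₀ s (x 0)) (d' (s, x 0) fun j => x j.succ),
      hTc, Continuous.matrixVecCons (hd₀c.comp hsplit₀) (hd'c.comp hsplit), ?_, ?_, ?_, ?_, ?_⟩
    · intro s x i
      refine Fin.cases ?_ (fun j => ?_) i
      · simpa [hT] using hT₀d s (x 0)
      · have h := hT'd (s, x 0) (fun j => x j.succ) j
        have h1 : ∀ t, (fun l : Fin k => Function.update x j.succ t l.succ)
            = Function.update (fun j => x j.succ) j t := by
          intro t
          ext l
          by_cases hl : l = j
          · subst hl; simp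
          · simp [Function.update_of_ne hl, Function.update_of_ne
              (fun h => hl (Fin.succ_injective _ h) : l.succ ≠ j.succ)]
        have h2 : ∀ t, Function.update x j.succ t 0 = x 0 := fun t =>
          Function.update_of_ne (Fin.succ_ne_zero j).symm _ _
        simpa [hT, h1, h2] using h
    · intro s x i
      refine Fin.cases ?_ (fun j => ?_) i
      · simpa using hd₀pos _ _
      · simpa using hd'pos _ _ _
    · intro s x
      have hx : Matrix.vecCons (x 0) (fun j => x j.succ) = x := Matrix.cons_head_tail x
      have h1 := hT'FG (s, x 0) fun j => x j.succ
      have h2 := hT₀FG s (x 0)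
      simp only [hF', hG', hx] at h1
      rw [div_eq_iff (hF₀pos _ _).ne', h2] at h1
      rw [Fin.prod_univ_succ]
      simp only [Matrix.cons_val_zero, Matrix.cons_val_succ, hT]
      rw [h1]
      have := (hG₀pos s (T₀ s (x 0))).ne'
      field_simp
    · intro s x hx
      rw [mem_cube] at hx ⊢
      intro i
      have hmono : StrictMono (T₀ s) := strictMono_of_hasDerivAt_pos (hT₀d s) (hd₀pos s)
      refine Fin.cases ?_ (fun j => ?_) i
      · simp only [hT, Matrix.cons_val_zero]
        exact ⟨hT₀l s ▸ hmono.monotone (hx 0).1, (hmono.monotone (hx 0).2).trans_eq (hT₀r s)⟩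
      · simp only [hT, Matrix.cons_val_succ]
        exact mem_cube.1 (hT'Q (s, x 0) _ (mem_cube.2 fun j => hx j.succ)) j
    · intro s φ hφ
      set h : ℝ → ℝ := fun t => ∫ y in cube k L, φ (Matrix.vecCons t y) * G s (Matrix.vecCons t y)
        with hh
      have hφG : Continuous fun y => φ y * G s y := hφ.mul (hGs s)
      have hhc : Continuous h := by
        apply continuous_integral_cube (f := fun t y =>
          φ (Matrix.vecCons t y) * G s (Matrix.vecCons t y))
        have : Continuous fun q : ℝ × (Fin k → ℝ) => Matrix.vecCons q.1 q.2 := by fun_prop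
        exact hφG.comp this
      have hφF : Continuous fun x => φ (T s x) * F s x :=
        (hφ.comp (hTc.comp (Continuous.prodMk_right s))).mul (hFs s)
      rw [integral_cube_vecCons hL.le hφG, integral_cube_vecCons hL.le hφF]
      have hcv := intervalIntegral.integral_comp_mul_deriv (a := -L) (b := L)
        (fun t _ => hT₀d s t) (hd₀c.comp (Continuous.prodMk_right s)).continuousOn hhc
      rw [hT₀l, hT₀r] at hcv
      rw [← hcv]
      refine intervalIntegral.integral_congr fun t _ => ?_
      have h3 := hT'φ (s, t) (fun y => φ (Matrix.vecCons (T₀ s t) y)) (by fun_prop)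
      simp only [hF', hG', mul_div_assoc', integral_div] at h3
      rw [div_eq_div_iff (hF₀pos _ _).ne' (hG₀pos _ _).ne', hT₀FG s t] at h3
      simp only [hT, Matrix.cons_val_zero, Matrix.cons_val_succ, Function.comp, hh]
      have := (hG₀pos s (T₀ s t)).ne'
      apply mul_right_cancel₀ this
      rw [h3]
      ring

lemma le_sqrt_mul_of_forall_pos {X P E : ℝ} (hP : 0 < P)
    (h : ∀ l : ℝ, 0 < l → 2 * X ≤ l * P + l⁻¹ * E) : X ≤ √(P * E) := by
  rcases le_or_gt X 0 with hX | hX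
  · exact hX.trans (Real.sqrt_nonneg _)
  · apply Real.le_sqrt_of_sq_le
    have h1 := h (X / P) (by positivity)
    rw [inv_div, div_mul_cancel₀ _ hP.ne'] at h1
    have h2 : X ≤ P / X * E := by linarith
    rw [div_mul_eq_mul_div, le_div_iff₀ hX] at h2
    nlinarith

/-- The Cauchy density `(1 + |y|²)^{-k}` up to normalization. -/
noncomputable def cauchyKernel (k : ℕ) (y : Fin k → ℝ) : ℝ := ((1 + ∑ i, y i ^ 2) ^ k)⁻¹

lemma one_le_one_add_sum_sq {k : ℕ} (y : Fin k → ℝ) : 1 ≤ 1 + ∑ i, y i ^ 2 := by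
  have : 0 ≤ ∑ i, y i ^ 2 := Finset.sum_nonneg fun i _ => sq_nonneg _
  linarith

lemma continuous_cauchyKernel (k : ℕ) : Continuous (cauchyKernel k) := by
  unfold cauchyKernel
  refine Continuous.inv₀ (by fun_prop) fun y => ?_
  have := one_le_one_add_sum_sq y
  positivity

lemma cauchyKernel_pos {k : ℕ} (y : Fin k → ℝ) : 0 < cauchyKernel k y := by
  have := one_le_one_add_sum_sq y
  unfold cauchyKernel
  positivity

lemma cauchyKernel_le_one {k : ℕ} (y : Fin k → ℝ) : cauchyKernel k y ≤ 1 :=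
  inv_le_one_of_one_le₀ (one_le_pow₀ (one_le_one_add_sum_sq y))

lemma le_cauchyKernel {k : ℕ} {L : ℝ} {y : Fin k → ℝ} (hy : y ∈ cube k L) :
    ((1 + k * L ^ 2) ^ k)⁻¹ ≤ cauchyKernel k y := by
  have h1 := one_le_one_add_sum_sq y
  have h2 : ∑ i, y i ^ 2 ≤ k * L ^ 2 := by
    calc ∑ i, y i ^ 2 ≤ ∑ _i : Fin k, L ^ 2 := by
          refine Finset.sum_le_sum fun i _ => sq_le_sq' ?_ ?_
          · exact (mem_cube.1 hy i).1
          · exact (mem_cube.1 hy i).2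
      _ = k * L ^ 2 := by simp
  unfold cauchyKernel
  gcongr

/-- Transport of a positive density onto the Cauchy kernel of a cube. -/
lemma exists_transport_cauchyKernel {k : ℕ} {L : ℝ} (hL : 0 < L) {F : (Fin k → ℝ) → ℝ}
    (hF : Continuous F) (hFpos : ∀ x, 0 < F x)
    (hmass : ∫ x in cube k L, F x = ∫ y in cube k L, cauchyKernel k y) :
    ∃ T d : (Fin k → ℝ) → (Fin k → ℝ), Continuous T ∧ Continuous d ∧
      (∀ x i, HasDerivAt (fun t => T (Function.update x i t) i) (d x i) (x i)) ∧
      (∀ x i, 0 < d x i) ∧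
      (∀ x ∈ cube k L, F x * (1 + ∑ i, T x i ^ 2) ^ k = ∏ i, d x i) ∧
      (∀ x ∈ cube k L, T x ∈ cube k L) ∧
      (∀ φ : (Fin k → ℝ) → ℝ, Continuous φ →
        ∫ x in cube k L, φ (T x) * F x = ∫ y in cube k L, φ y * cauchyKernel k y) := by
  set m : ℝ := ((1 + k * L ^ 2) ^ k)⁻¹ with hm
  have hmpos : 0 < m := by positivity
  have hmax : ∀ y ∈ cube k L, max (cauchyKernel k y) m = cauchyKernel k y := fun y hy =>
    max_eq_left (le_cauchyKernel hy)
  have hm1 : m ≤ 1 := inv_le_one_of_one_le₀ (one_le_pow₀ (by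
    have : 0 ≤ k * L ^ 2 := by positivity
    linarith))
  obtain ⟨T, d, hT, hd, hTd, hdpos, hFG, hTQ, hφ⟩ := exists_knothe_transport hL k (P := Unit)
    (F := fun _ => F) (G := fun _ y => max (cauchyKernel k y) m) (hF.comp continuous_snd)
    (((continuous_cauchyKernel k).comp continuous_snd).max continuous_const)
    (fun _ => hFpos) hmpos (fun _ _ => le_max_right _ _)
    (fun _ y => max_le (cauchyKernel_le_one y) hm1)
    (fun _ => hmass.trans (setIntegral_congr_fun (measurableSet_cube k L)
      fun y hy => (hmax y hy).symm))
  refine ⟨T (), d (), hT.comp (Continuous.prodMk_right ()), hd.comp (Continuous.prodMk_right ()),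
    hTd (), hdpos (), ?_, hTQ (), ?_⟩
  · intro x hx
    have h := hFG () x
    rw [hmax _ (hTQ () x hx)] at h
    rw [h, cauchyKernel]
    have := one_le_one_add_sum_sq (T () x)
    field_simp
  · intro φ hφc
    rw [hφ () φ hφc]
    exact setIntegral_congr_fun (measurableSet_cube k L) fun y hy => by
      simp only [hmax y hy]

/-- The arithmetic-geometric mean inequality for the Jacobian of the transport. -/
lemma mul_le_rpow_mul_sum {n : ℕ} (hn : 0 < n) {F h : ℝ} (hF : 0 < F) (hh : 0 ≤ h)
    {d : Fin n → ℝ} (hd : ∀ i, 0 < d i) (heq : F * h ^ n = ∏ i, d i) :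
    h * F ≤ F ^ (1 - 1 / (n : ℝ)) * ((1 / n) * ∑ i, d i) := by
  have hn' : (n : ℝ) ≠ 0 := by positivity
  have amgm := Real.geom_mean_le_arith_mean_weighted Finset.univ (fun _ : Fin n => 1 / (n : ℝ)) d
    (fun _ _ => by positivity) (by simp [hn']) (fun i _ => (hd i).le)
  rw [← Finset.mul_sum, Real.finsetProd_rpow _ _ (fun i _ => (hd i).le), ← heq,
    Real.mul_rpow hF.le (by positivity), one_div, Real.pow_rpow_inv_natCast hh hn.ne'] at amgm
  calc h * F = F ^ (1 - 1 / (n : ℝ)) * (F ^ (n : ℝ)⁻¹ * h) := by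
        rw [← mul_assoc, ← Real.rpow_add hF, one_div, sub_add_cancel, Real.rpow_one, mul_comm]
    _ ≤ _ := by
        rw [one_div] at *
        gcongr

/-- Sharp Sobolev inequality on a cube for positive functions, up to a boundary term. -/
theorem sobolev_cube {k : ℕ} (hk : 2 ≤ k) {L ε : ℝ} (hL : 0 < L) (hε : 0 ≤ ε)
    {f : (Fin (k + 1) → ℝ) → ℝ} {g : (Fin (k + 1) → ℝ) → Fin (k + 1) → ℝ}
    (hf : Continuous f) (hg : Continuous g) (hfpos : ∀ x, 0 < f x)
    (hfg : ∀ x i, HasDerivAt (fun t => f (Function.update x i t)) (g x i) (x i))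
    (hbd : ∀ x ∈ cube (k + 1) L, ∀ i, x i = L ∨ x i = -L → f x ≤ ε)
    {N a c : ℝ} (hN : N = k + 1) (ha : a = 2 * (N - 1) / (N - 2)) (hc : 0 < c)
    (hmass : c * ∫ x in cube (k + 1) L, f x ^ (2 * N / (N - 2))
      = ∫ y in cube (k + 1) L, cauchyKernel (k + 1) y) :
    ∫ y in cube (k + 1) L, (1 + ∑ i, y i ^ 2) * cauchyKernel (k + 1) y
      ≤ c ^ (1 - 1 / N) * ((2 * L) ^ (k + 1) * ε ^ a) + c ^ (1 - 1 / N) * (a / N) *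
        √((∫ y in cube (k + 1) L, (∑ i, y i ^ 2) * cauchyKernel (k + 1) y) / c *
          ∫ x in cube (k + 1) L, ∑ i, g x i ^ 2) := by
  have hN3 : 3 ≤ N := by
    have : (2 : ℝ) ≤ k := by exact_mod_cast hk
    linarith
  have hN2 : 0 < N - 2 := by linarith
  have hapos : 0 < a := by
    rw [ha]
    exact div_pos (by linarith) hN2
  set q : ℝ := 2 * N / (N - 2) with hq
  have hqa : q * (1 - 1 / N) = a := by
    rw [hq, ha]
    field_simp
  have hqa' : 2 * (a - 1) = q := by
    rw [hq, ha]
    field_simp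
    ring
  set Q := cube (k + 1) L with hQ
  have hQm : MeasurableSet Q := measurableSet_cube _ _
  have hfr : ∀ b : ℝ, Continuous fun x => f x ^ b := fun b =>
    hf.rpow_const fun x => Or.inl (hfpos x).ne'
  obtain ⟨T, d, hT, hd, hTd, hdpos, hjac, hTQ, hφ⟩ := exists_transport_cauchyKernel hL
    (F := fun x => c * f x ^ q) (continuous_const.mul (hfr q))
    (fun x => mul_pos hc (Real.rpow_pos_of_pos (hfpos x) _)) (by
      rw [integral_const_mul, ← hmass])
  have hTi : ∀ i, Continuous fun x => T x i := fun i => (continuous_apply i).comp hT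
  have hdi : ∀ i, Continuous fun x => d x i := fun i => (continuous_apply i).comp hd
  have hgi : ∀ i, Continuous fun x => g x i := fun i => (continuous_apply i).comp hg
  -- integration by parts in each coordinate
  have hparts : ∀ i, ∫ x in Q, (f x ^ a * d x i + a * f x ^ (a - 1) * g x i * T x i)
      ≤ (2 * L) ^ (k + 1) * ε ^ a := by
    intro i
    have hderiv : ∀ x, HasDerivAt (fun t => f (Function.update x i t) ^ a *
        T (Function.update x i t) i)
        (f x ^ a * d x i + a * f x ^ (a - 1) * g x i * T x i) (x i) := by
      intro x
      have h1 := (hfg x i).rpow_const (p := a) (Or.inl (by simpa using (hfpos x).ne'))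
      have h2 := h1.mul (hTd x i)
      simp only [Function.update_eq_self] at h2
      exact h2.congr_deriv (by ring)
    have hcont : Continuous fun x => f x ^ a * d x i + a * f x ^ (a - 1) * g x i * T x i :=
      ((hfr a).mul (hdi i)).add (((continuous_const.mul (hfr _)).mul (hgi i)).mul (hTi i))
    rw [hQ, integral_cube_deriv hL.le i (g := fun x => f x ^ a * T x i) hcont hderiv]
    have hins : ∀ t : ℝ, Continuous fun y : Fin k → ℝ => i.insertNth (α := fun _ => ℝ) t y :=
      fun t => Continuous.finInsertNth (A := fun _ => ℝ) i continuous_const continuous_id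
    have hfT : Continuous fun x => f x ^ a * T x i := (hfr a).mul (hTi i)
    have hface : ∀ t, t = L ∨ t = -L → ∀ y ∈ cube k L,
        |f (i.insertNth (α := fun _ => ℝ) t y) ^ a * T (i.insertNth (α := fun _ => ℝ) t y) i|
          ≤ ε ^ a * L := by
      intro t ht y hy
      have hmem : i.insertNth (α := fun _ => ℝ) t y ∈ cube (k + 1) L := by
        rw [mem_cube, Fin.forall_iff_succAbove i]
        refine ⟨?_, fun j => by simpa using mem_cube.1 hy j⟩
        rcases ht with rfl | rfl <;> simp [hL.le]
      have h1 := hbd _ hmem i (by simpa using ht)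
      have h2 := mem_cube.1 (hTQ _ hmem) i
      rw [abs_mul, abs_of_pos (Real.rpow_pos_of_pos (hfpos _) _)]
      have h3 := abs_le.2 h2
      have h4 := (hfpos (i.insertNth (α := fun _ => ℝ) t y)).le
      gcongr
    calc _ ≤ (2 * (ε ^ a * L)) * (2 * L) ^ k := by
          apply integral_cube_le hL.le ((hfT.comp (hins _)).sub (hfT.comp (hins _)))
          intro y hy
          have h1 := (abs_le.1 (hface L (Or.inl rfl) y hy)).2
          have h2 := (abs_le.1 (hface (-L) (Or.inr rfl) y hy)).1
          simp only [Pi.sub_apply, Function.comp]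
          linarith
      _ = _ := by ring
  have hsum : ∫ x in Q, f x ^ a * ∑ i, d x i
      ≤ N * ((2 * L) ^ (k + 1) * ε ^ a) + a * ∫ x in Q, f x ^ (a - 1) * -∑ i, g x i * T x i := by
    have hc1 : ∀ i, Continuous fun x => f x ^ a * d x i + a * f x ^ (a - 1) * g x i * T x i :=
      fun i => ((hfr a).mul (hdi i)).add
        (((continuous_const.mul (hfr _)).mul (hgi i)).mul (hTi i))
    have hc2 : Continuous fun x => a * (f x ^ (a - 1) * -∑ i, g x i * T x i) :=
      continuous_const.mul ((hfr _).mul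
        (continuous_finsetSum _ fun i _ => (hgi i).mul (hTi i)).neg)
    have h1 : ∀ x, f x ^ a * ∑ i, d x i
        = ∑ i, (f x ^ a * d x i + a * f x ^ (a - 1) * g x i * T x i)
          + a * (f x ^ (a - 1) * -∑ i, g x i * T x i) := by
      intro x
      rw [Finset.sum_add_distrib, ← Finset.mul_sum]
      simp only [mul_assoc, ← Finset.mul_sum]
      ring
    simp only [h1]
    rw [integral_add (integrableOn_cube (continuous_finsetSum _ fun i _ => hc1 i))
      (integrableOn_cube hc2), integral_finsetSum _ fun i _ => integrableOn_cube (hc1 i),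
      integral_const_mul]
    gcongr
    calc _ ≤ ∑ _i : Fin (k + 1), (2 * L) ^ (k + 1) * ε ^ a :=
          Finset.sum_le_sum fun i _ => hparts i
      _ = _ := by simp [hN]
  have hcs : ∫ x in Q, f x ^ (a - 1) * -∑ i, g x i * T x i
      ≤ √((∫ y in Q, (∑ i, y i ^ 2) * cauchyKernel (k + 1) y) / c *
          ∫ x in Q, ∑ i, g x i ^ 2) := by
    have hTsq := hφ (fun y => ∑ i, y i ^ 2) (by fun_prop)
    have hcT : Continuous fun x => (∑ i, T x i ^ 2) * f x ^ q :=
      (continuous_finsetSum _ fun i _ => (hTi i).pow 2).mul (hfr q)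
    have hcg : Continuous fun x => ∑ i, g x i ^ 2 :=
      continuous_finsetSum _ fun i _ => (hgi i).pow 2
    have hpos : 0 < ∫ y in Q, (∑ i, y i ^ 2) * cauchyKernel (k + 1) y := by
      have hcont : Continuous fun y : Fin (k + 1) → ℝ => (∑ i, y i ^ 2) * cauchyKernel (k + 1) y :=
        (by fun_prop : Continuous fun y : Fin (k + 1) → ℝ => ∑ i, y i ^ 2).mul
          (continuous_cauchyKernel _)
      have hnn : ∀ y : Fin (k + 1) → ℝ, 0 ≤ (∑ i, y i ^ 2) * cauchyKernel (k + 1) y := fun y =>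
        mul_nonneg (Finset.sum_nonneg fun i _ => sq_nonneg _) (cauchyKernel_pos y).le
      rw [setIntegral_pos_iff_support_of_nonneg_ae (Eventually.of_forall hnn)
        (integrableOn_cube hcont)]
      have hsub : Ioo (0 : ℝ) L ∈ 𝓝 (L / 2) := Ioo_mem_nhds (by linarith) (by linarith)
      have hopen : IsOpen (Set.pi univ fun _ : Fin (k + 1) => Ioo (0 : ℝ) L) :=
        isOpen_set_pi finite_univ fun _ _ => isOpen_Ioo
      refine (hopen.measure_pos volume ⟨fun _ => L / 2, fun _ _ => mem_of_mem_nhds hsub⟩).trans_le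
        (measure_mono fun y hy => ⟨?_, ?_⟩)
      · have h0 : 0 < ∑ i, y i ^ 2 := Finset.sum_pos (fun i _ => by
          have := (hy i trivial).1
          positivity) Finset.univ_nonempty
        exact (mul_pos h0 (cauchyKernel_pos y)).ne'
      · exact mem_cube.2 fun i => ⟨by linarith [(hy i trivial).1], (hy i trivial).2.le⟩
    refine le_sqrt_mul_of_forall_pos (by positivity) fun l hl => ?_
    have hTsq' : ∫ x in Q, (∑ i, T x i ^ 2) * f x ^ q
        = (∫ y in Q, (∑ i, y i ^ 2) * cauchyKernel (k + 1) y) / c := by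
      rw [eq_div_iff hc.ne', ← hTsq, ← integral_mul_const]
      congr 1 with x
      ring
    have hi1 : IntegrableOn (fun x => l * ((∑ i, T x i ^ 2) * f x ^ q)) Q :=
      integrableOn_cube (continuous_const.mul hcT)
    have hi2 : IntegrableOn (fun x => l⁻¹ * ∑ i, g x i ^ 2) Q :=
      integrableOn_cube (continuous_const.mul hcg)
    rw [← hTsq', ← integral_const_mul, ← integral_const_mul, ← integral_const_mul,
      ← integral_add hi1 hi2]
    refine setIntegral_mono (integrableOn_cube (continuous_const.mul ((hfr _).mul
      (continuous_finsetSum _ fun i _ => (hgi i).mul (hTi i)).neg))) (hi1.add hi2) ?_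
    intro x
    have hsq : f x ^ q = (f x ^ (a - 1)) ^ 2 := by
      rw [← hqa', mul_comm, Real.rpow_mul (hfpos x).le]
      norm_cast
    simp only [hsq]
    rw [Finset.sum_mul, Finset.mul_sum, Finset.mul_sum, ← Finset.sum_neg_distrib,
      Finset.mul_sum, Finset.mul_sum, ← Finset.sum_add_distrib]
    refine Finset.sum_le_sum fun i _ => ?_
    have hkey : 0 ≤ l⁻¹ * (l * (T x i * f x ^ (a - 1)) + g x i) ^ 2 := by positivity
    have : l⁻¹ * (l * (T x i * f x ^ (a - 1)) + g x i) ^ 2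
        = l * (T x i ^ 2 * (f x ^ (a - 1)) ^ 2) + l⁻¹ * g x i ^ 2
          - 2 * (f x ^ (a - 1) * -(g x i * T x i)) := by
      field_simp
      ring
    linarith
  have hB := hφ (fun y => 1 + ∑ i, y i ^ 2) (by fun_prop)
  have hNpos : 0 < N := by linarith
  calc ∫ y in Q, (1 + ∑ i, y i ^ 2) * cauchyKernel (k + 1) y
      = ∫ x in Q, (1 + ∑ i, T x i ^ 2) * (c * f x ^ q) := hB.symm
    _ ≤ ∫ x in Q, (c ^ (1 - 1 / N) * (1 / N)) * (f x ^ a * ∑ i, d x i) := by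
        refine setIntegral_mono_on
          (integrableOn_cube ((continuous_const.add
            (continuous_finsetSum _ fun i _ => (hTi i).pow 2)).mul (continuous_const.mul (hfr q))))
          (integrableOn_cube (continuous_const.mul ((hfr a).mul
            (continuous_finsetSum _ fun i _ => hdi i)))) hQm fun x hx => ?_
        have hfq : 0 < f x ^ q := Real.rpow_pos_of_pos (hfpos x) _
        have := mul_le_rpow_mul_sum k.succ_pos (mul_pos hc hfq)
          (zero_le_one.trans (one_le_one_add_sum_sq (T x))) (hdpos x) (hjac x hx)
        refine this.trans_eq ?_
        have hcast : ((k.succ : ℕ) : ℝ) = N := by rw [hN]; push_cast; rfl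
        rw [hcast, Real.mul_rpow hc.le hfq.le, ← Real.rpow_mul (hfpos x).le, hqa]
        ring
    _ = (c ^ (1 - 1 / N) * (1 / N)) * ∫ x in Q, f x ^ a * ∑ i, d x i := integral_const_mul _ _
    _ ≤ (c ^ (1 - 1 / N) * (1 / N)) * (N * ((2 * L) ^ (k + 1) * ε ^ a) + a *
          √((∫ y in Q, (∑ i, y i ^ 2) * cauchyKernel (k + 1) y) / c *
            ∫ x in Q, ∑ i, g x i ^ 2)) := by
        refine mul_le_mul_of_nonneg_left (hsum.trans ?_) (by positivity)
        gcongr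
    _ = _ := by
        field_simp

/-- The integral of `(1 + |y|²)^{-s}` over Euclidean space. -/
lemma integral_rpow_neg_one_add_norm_sq {k : ℕ} {s : ℝ} (hs : (k : ℝ) / 2 < s) :
    ∫ y : EuclideanSpace ℝ (Fin k), (1 + ‖y‖ ^ 2) ^ (-s)
      = Real.pi ^ ((k : ℝ) / 2) * Real.Gamma (s - k / 2) / Real.Gamma s := by
  have hk : 0 ≤ (k : ℝ) / 2 := by positivity
  have hs0 : 0 < s := hk.trans_lt hs
  have hint : Integrable fun y : EuclideanSpace ℝ (Fin k) => (1 + ‖y‖ ^ 2) ^ (-s) := by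
    have := integrable_rpow_neg_one_add_norm_sq (E := EuclideanSpace ℝ (Fin k)) (r := 2 * s)
      (μ := volume) (by simp; linarith)
    refine this.congr (Eventually.of_forall fun y => ?_)
    simp only
    congr 1
    ring
  set K : EuclideanSpace ℝ (Fin k) → ℝ → ℝ := fun y t =>
    t ^ (s - 1) * Real.exp (-((1 + ‖y‖ ^ 2) * t)) with hK
  have hKt : ∀ y, ∫ t in Ioi (0 : ℝ), K y t = (1 + ‖y‖ ^ 2) ^ (-s) * Real.Gamma s := by
    intro y
    have h1 : 0 < 1 + ‖y‖ ^ 2 := by positivity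
    rw [hK, Real.integral_rpow_mul_exp_neg_mul_Ioi hs0 h1, one_div, Real.inv_rpow h1.le,
      Real.rpow_neg h1.le]
  have hKi : ∀ y, IntegrableOn (K y) (Ioi 0) := by
    intro y
    by_contra h
    have h1 := hKt y
    rw [integral_undef h] at h1
    have : 0 < (1 + ‖y‖ ^ 2) ^ (-s) * Real.Gamma s :=
      mul_pos (by positivity) (Real.Gamma_pos_of_pos hs0)
    linarith
  have hmeas : Measurable (Function.uncurry K) := by
    simp only [hK, Function.uncurry_def]
    fun_prop
  have hprod : Integrable (Function.uncurry K)
      ((volume : Measure (EuclideanSpace ℝ (Fin k))).prod (volume.restrict (Ioi 0))) := by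
    rw [integrable_prod_iff hmeas.aestronglyMeasurable]
    refine ⟨Eventually.of_forall fun y => hKi y, ?_⟩
    refine (hint.mul_const (Real.Gamma s)).congr (Eventually.of_forall fun y => ?_)
    simp only
    rw [← hKt]
    refine setIntegral_congr_fun measurableSet_Ioi fun t ht => ?_
    have ht' : (0 : ℝ) < t := ht
    simp only [Function.uncurry, hK]
    rw [Real.norm_of_nonneg (by positivity)]
  have hswap := integral_integral_swap hprod
  simp only [hKt, integral_mul_const] at hswap
  rw [eq_div_iff (Real.Gamma_pos_of_pos hs0).ne', hswap]
  have hKy : ∀ t ∈ Ioi (0 : ℝ), ∫ y, K y t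
      = Real.pi ^ ((k : ℝ) / 2) * (t ^ (s - k / 2 - 1) * Real.exp (-(1 * t))) := by
    intro t ht
    have ht' : (0 : ℝ) < t := ht
    have h1 : ∀ y : EuclideanSpace ℝ (Fin k),
        K y t = (t ^ (s - 1) * Real.exp (-(1 * t))) * Real.exp (-t * ‖y‖ ^ 2) := by
      intro y
      rw [mul_assoc, ← Real.exp_add, hK]
      simp only
      congr 2
      ring
    simp only [h1, integral_const_mul]
    rw [GaussianFourier.integral_rexp_neg_mul_sq_norm ht', finrank_euclideanSpace_fin,
      Real.div_rpow Real.pi_pos.le ht'.le,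
      show s - (k : ℝ) / 2 - 1 = (s - 1) - k / 2 by ring, Real.rpow_sub ht' (s - 1)]
    ring
  rw [setIntegral_congr_fun measurableSet_Ioi hKy, integral_const_mul,
    Real.integral_rpow_mul_exp_neg_mul_Ioi (by linarith) one_pos]
  simp

lemma integrable_rpow_neg_one_add_sum_sq {k : ℕ} {s : ℝ} (hs : (k : ℝ) / 2 < s) :
    Integrable fun y : Fin k → ℝ => (1 + ∑ i, y i ^ 2) ^ (-s) := by
  have := integrable_rpow_neg_one_add_norm_sq (E := EuclideanSpace ℝ (Fin k)) (r := 2 * s)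
      (μ := volume) (by simp; linarith)
  rw [← (PiLp.volume_preserving_toLp (Fin k)).integrable_comp_emb
    (MeasurableEquiv.toLp 2 (Fin k → ℝ)).measurableEmbedding] at this
  refine this.congr (Eventually.of_forall fun y => ?_)
  simp only [Function.comp, EuclideanSpace.real_norm_sq_eq]
  congr 1
  ring

lemma integral_rpow_neg_one_add_sum_sq {k : ℕ} {s : ℝ} (hs : (k : ℝ) / 2 < s) :
    ∫ y : Fin k → ℝ, (1 + ∑ i, y i ^ 2) ^ (-s)
      = Real.pi ^ ((k : ℝ) / 2) * Real.Gamma (s - k / 2) / Real.Gamma s := by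
  rw [← integral_rpow_neg_one_add_norm_sq hs,
    ← (PiLp.volume_preserving_toLp (Fin k)).integral_comp
      (MeasurableEquiv.toLp 2 (Fin k → ℝ)).measurableEmbedding]
  simp only [EuclideanSpace.real_norm_sq_eq]

lemma cauchyKernel_eq_rpow {k : ℕ} (y : Fin k → ℝ) :
    cauchyKernel k y = (1 + ∑ i, y i ^ 2) ^ (-(k : ℝ)) := by
  have := one_le_one_add_sum_sq y
  rw [Real.rpow_neg (by positivity), Real.rpow_natCast, cauchyKernel]

lemma mul_cauchyKernel_eq_rpow {k : ℕ} (y : Fin k → ℝ) :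
    (1 + ∑ i, y i ^ 2) * cauchyKernel k y = (1 + ∑ i, y i ^ 2) ^ (-((k : ℝ) - 1)) := by
  have := one_le_one_add_sum_sq y
  rw [neg_sub, sub_eq_add_neg, Real.rpow_add (by positivity), Real.rpow_one,
    ← cauchyKernel_eq_rpow]

lemma integrable_cauchyKernel {k : ℕ} (hk : 0 < k) : Integrable (cauchyKernel k) := by
  have h : (0 : ℝ) < k := by exact_mod_cast hk
  exact (integrable_rpow_neg_one_add_sum_sq (by linarith)).congr
    (Eventually.of_forall fun y => (cauchyKernel_eq_rpow y).symm)

lemma integrable_mul_cauchyKernel {k : ℕ} (hk : 3 ≤ k) :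
    Integrable fun y : Fin k → ℝ => (1 + ∑ i, y i ^ 2) * cauchyKernel k y := by
  have h : (3 : ℝ) ≤ k := by exact_mod_cast hk
  exact (integrable_rpow_neg_one_add_sum_sq (by linarith)).congr
    (Eventually.of_forall fun y => (mul_cauchyKernel_eq_rpow y).symm)

lemma integral_cauchyKernel {k : ℕ} (hk : 0 < k) :
    ∫ y, cauchyKernel k y
      = Real.pi ^ ((k : ℝ) / 2) * Real.Gamma ((k : ℝ) / 2) / Real.Gamma k := by
  have h : (0 : ℝ) < k := by exact_mod_cast hk
  simp only [cauchyKernel_eq_rpow]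
  rw [integral_rpow_neg_one_add_sum_sq (by linarith), sub_half]

lemma integral_mul_cauchyKernel {k : ℕ} (hk : 3 ≤ k) :
    ∫ y : Fin k → ℝ, (1 + ∑ i, y i ^ 2) * cauchyKernel k y
      = 2 * (k - 1) / (k - 2) * ∫ y, cauchyKernel k y := by
  have h : (3 : ℝ) ≤ k := by exact_mod_cast hk
  rw [integral_cauchyKernel (by omega)]
  simp only [mul_cauchyKernel_eq_rpow]
  rw [integral_rpow_neg_one_add_sum_sq (by linarith)]
  have h1 : Real.Gamma ((k : ℝ) / 2) = (k / 2 - 1) * Real.Gamma ((k : ℝ) / 2 - 1) := by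
    rw [← Real.Gamma_add_one (by linarith), sub_add_cancel]
  have h2 : Real.Gamma (k : ℝ) = (k - 1) * Real.Gamma ((k : ℝ) - 1) := by
    rw [← Real.Gamma_add_one (by linarith), sub_add_cancel]
  have h3 : 0 < Real.Gamma ((k : ℝ) - 1) := Real.Gamma_pos_of_pos (by linarith)
  rw [h1, h2, show (k : ℝ) - 1 - k / 2 = k / 2 - 1 by ring]
  have h4 : (k : ℝ) - 1 ≠ 0 := by linarith
  have h5 : (k : ℝ) - 2 ≠ 0 := by linarith
  field_simp

lemma integrable_sum_sq_mul_cauchyKernel {k : ℕ} (hk : 3 ≤ k) :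
    Integrable fun y : Fin k → ℝ => (∑ i, y i ^ 2) * cauchyKernel k y :=
  ((integrable_mul_cauchyKernel hk).sub (integrable_cauchyKernel (by omega))).congr
    (Eventually.of_forall fun y => by simp only [Pi.sub_apply]; ring)

lemma integral_sum_sq_mul_cauchyKernel {k : ℕ} (hk : 3 ≤ k) :
    ∫ y : Fin k → ℝ, (∑ i, y i ^ 2) * cauchyKernel k y
      = k / (k - 2) * ∫ y, cauchyKernel k y := by
  have h : (3 : ℝ) ≤ k := by exact_mod_cast hk
  have h5 : (k : ℝ) - 2 ≠ 0 := by linarith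
  have h1 : ∀ y : Fin k → ℝ, (∑ i, y i ^ 2) * cauchyKernel k y
      = (1 + ∑ i, y i ^ 2) * cauchyKernel k y - cauchyKernel k y := fun y => by ring
  simp only [h1]
  rw [integral_sub (integrable_mul_cauchyKernel hk) (integrable_cauchyKernel (by omega)),
    integral_mul_cauchyKernel hk]
  field_simp
  ring

lemma cube_mono {k : ℕ} : Monotone (cube k) := fun _ _ h =>
  Icc_subset_Icc (fun _ => neg_le_neg h) (fun _ => h)

lemma iUnion_cube (k : ℕ) : ⋃ L : ℝ, cube k L = univ := by
  refine eq_univ_of_forall fun x => mem_iUnion.2 ⟨‖x‖, mem_cube.2 fun i => ?_⟩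
  exact abs_le.1 (norm_le_pi_norm x i)

/-- Sharp Sobolev inequality on a large cube, with the extremal function truncated. -/
lemma sobolev_truncated {k : ℕ} (hk : 2 ≤ k) {L : ℝ} (hL : 0 < L)
    {v : (Fin (k + 1) → ℝ) → ℝ} {D : (Fin (k + 1) → ℝ) → Fin (k + 1) → ℝ}
    (hv : Continuous v) (hD : Continuous D)
    (hvD : ∀ x i, HasDerivAt (fun t => v (Function.update x i t)) (D x i) (x i))
    (hbd : ∀ x i, L ≤ |x i| → v x = 0)
    {N a A C J E : ℝ} (hN : N = k + 1) (ha : a = 2 * (N - 1) / (N - 2))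
    (hA : ∫ y in cube (k + 1) L, cauchyKernel (k + 1) y ≤ A)
    (hC : ∫ y in cube (k + 1) L, (∑ i, y i ^ 2) * cauchyKernel (k + 1) y ≤ C)
    (hJ : J = ∫ x in cube (k + 1) L, |v x| ^ (2 * N / (N - 2))) (hJpos : 0 < J)
    (hE : ∫ x in cube (k + 1) L, ∑ i, D x i ^ 2 ≤ E) :
    ∫ y in cube (k + 1) L, (1 + ∑ i, y i ^ 2) * cauchyKernel (k + 1) y
      ≤ (A / J) ^ (1 / 2 - 1 / N) * (a / N) * √(C * E) := by
  have hN3 : 3 ≤ N := by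
    have : (2 : ℝ) ≤ k := by exact_mod_cast hk
    linarith
  have hN2 : 0 < N - 2 := by linarith
  have hapos : 0 < a := by
    rw [ha]
    exact div_pos (by linarith) hN2
  have hNhalf : 0 < 1 / 2 - 1 / N := by
    rw [sub_pos]
    exact one_div_lt_one_div_of_lt two_pos (by linarith)
  have hNone : 0 < 1 - 1 / N := by linarith
  set q : ℝ := 2 * N / (N - 2) with hq
  have hqpos : 0 < q := div_pos (by linarith) hN2
  set Q := cube (k + 1) L with hQ
  have hALpos : 0 < ∫ y in Q, cauchyKernel (k + 1) y :=
    integral_cube_pos hL (continuous_cauchyKernel _) cauchyKernel_pos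
  have hsqc : Continuous fun y : Fin (k + 1) → ℝ => ∑ i, y i ^ 2 := by fun_prop
  have hC0 : 0 ≤ ∫ y in Q, (∑ i, y i ^ 2) * cauchyKernel (k + 1) y :=
    integral_nonneg fun y =>
      mul_nonneg (Finset.sum_nonneg fun i _ => sq_nonneg _) (cauchyKernel_pos y).le
  have hDsq : Continuous fun x => ∑ i, D x i ^ 2 :=
    continuous_finsetSum _ fun i _ => ((continuous_apply i).comp hD).pow 2
  have hE0 : 0 ≤ ∫ x in Q, ∑ i, D x i ^ 2 :=
    integral_nonneg fun y => Finset.sum_nonneg fun i _ => sq_nonneg _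
  have hAJ : 0 < A / J := div_pos (hALpos.trans_le hA) hJpos
  have key : ∀ ε : ℝ, 0 < ε →
      ∫ y in Q, (1 + ∑ i, y i ^ 2) * cauchyKernel (k + 1) y
        ≤ (A / J) ^ (1 - 1 / N) * ((2 * L) ^ (k + 1) * ε ^ a)
          + (A / J) ^ (1 / 2 - 1 / N) * (a / N) * √(C * E) := by
    intro ε hε
    set f : (Fin (k + 1) → ℝ) → ℝ := fun x => √(v x ^ 2 + ε ^ 2) with hf
    have hpos : ∀ x, 0 < v x ^ 2 + ε ^ 2 := fun x => by positivity
    have hfpos : ∀ x, 0 < f x := fun x => Real.sqrt_pos.2 (hpos x)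
    have hfc : Continuous f := ((hv.pow 2).add continuous_const).sqrt
    have hvf : ∀ x, |v x| ≤ f x := fun x =>
      Real.abs_le_sqrt (by have := sq_nonneg ε; linarith)
    set g : (Fin (k + 1) → ℝ) → Fin (k + 1) → ℝ := fun x i => v x * D x i / f x with hg
    have hgc : Continuous g := continuous_pi fun i =>
      (hv.mul ((continuous_apply i).comp hD)).div hfc fun x => (hfpos x).ne'
    have hfg : ∀ x i, HasDerivAt (fun t => f (Function.update x i t)) (g x i) (x i) := by
      intro x i
      have h1 := ((hvD x i).pow 2).add_const (ε ^ 2)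
      have h2 := h1.sqrt (by simpa using (hpos x).ne')
      refine h2.congr_deriv ?_
      simp only [Pi.pow_apply, Function.update_eq_self, hg, hf]
      have := (hfpos x).ne'
      simp only [hf] at this
      field_simp
      norm_num
      ring
    have hfq : Continuous fun x => f x ^ q := hfc.rpow_const fun x => Or.inl (hfpos x).ne'
    have hJε : J ≤ ∫ x in Q, f x ^ q := by
      rw [hJ]
      refine setIntegral_mono (integrableOn_cube (hv.abs.rpow_const fun x => Or.inr hqpos.le))
        (integrableOn_cube hfq) fun x => ?_
      exact Real.rpow_le_rpow (abs_nonneg _) (hvf x) hqpos.le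
    have hJεpos := hJpos.trans_le hJε
    set c : ℝ := (∫ y in Q, cauchyKernel (k + 1) y) / ∫ x in Q, f x ^ q with hc
    have hcpos : 0 < c := div_pos hALpos hJεpos
    have hcle : c ≤ A / J := div_le_div₀ (hALpos.le.trans hA) hA hJpos hJε
    have hgE : ∫ x in Q, ∑ i, g x i ^ 2 ≤ E := by
      refine le_trans (setIntegral_mono (integrableOn_cube
        (continuous_finsetSum _ fun i _ => ((continuous_apply i).comp hgc).pow 2))
        (integrableOn_cube hDsq) fun x => ?_) hE
      refine Finset.sum_le_sum fun i _ => ?_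
      have h1 : v x ^ 2 ≤ f x ^ 2 := sq_le_sq' (neg_le_of_abs_le (hvf x)) (le_of_abs_le (hvf x))
      simp only [hg]
      rw [div_pow, mul_pow, div_le_iff₀ (pow_pos (hfpos x) 2), mul_comm]
      gcongr
    have hgE0 : 0 ≤ ∫ x in Q, ∑ i, g x i ^ 2 :=
      integral_nonneg fun y => Finset.sum_nonneg fun i _ => sq_nonneg _
    have h := sobolev_cube hk hL hε.le hfc hgc hfpos hfg (by
      intro x _ i hx
      have : v x = 0 := hbd x i (by rcases hx with h | h <;> simp [h, le_abs_self])
      simp [hf, this, Real.sqrt_sq hε.le]) hN ha hcpos (by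
        rw [hc, div_mul_cancel₀]
        exact hJεpos.ne')
    refine h.trans ?_
    have hsplit : c ^ (1 - 1 / N) * (a / N) *
        √((∫ y in Q, (∑ i, y i ^ 2) * cauchyKernel (k + 1) y) / c *
          ∫ x in Q, ∑ i, g x i ^ 2)
        = c ^ (1 / 2 - 1 / N) * (a / N) *
          √((∫ y in Q, (∑ i, y i ^ 2) * cauchyKernel (k + 1) y) * ∫ x in Q, ∑ i, g x i ^ 2) := by
      rw [div_mul_eq_mul_div, Real.sqrt_div (mul_nonneg hC0 hgE0),
        show 1 - 1 / N = (1 / 2 - 1 / N) + 1 / 2 by ring, Real.rpow_add hcpos,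
        ← Real.sqrt_eq_rpow]
      have := (Real.sqrt_pos.2 hcpos).ne'
      field_simp
    rw [hsplit]
    have hNpos : 0 < N := by linarith
    have hCnn : 0 ≤ C := hC0.trans hC
    gcongr
  have hlim : Tendsto (fun ε : ℝ => (A / J) ^ (1 - 1 / N) * ((2 * L) ^ (k + 1) * ε ^ a)
          + (A / J) ^ (1 / 2 - 1 / N) * (a / N) * √(C * E)) (𝓝[>] 0)
      (𝓝 ((A / J) ^ (1 / 2 - 1 / N) * (a / N) * √(C * E))) := by
    have hcont : Continuous fun ε : ℝ => (A / J) ^ (1 - 1 / N) * ((2 * L) ^ (k + 1) * ε ^ a)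
          + (A / J) ^ (1 / 2 - 1 / N) * (a / N) * √(C * E) :=
      (continuous_const.mul (continuous_const.mul
        (Real.continuous_rpow_const hapos.le))).add continuous_const
    have := hcont.tendsto 0
    simp only [Real.zero_rpow hapos.ne', mul_zero, zero_add] at this
    exact this.mono_left nhdsWithin_le_nhds
  exact ge_of_tendsto hlim (eventually_mem_nhdsWithin.mono fun ε hε => key ε hε)

/-- The sharp Sobolev inequality in coordinates. -/
theorem sobolev_coordinates {k : ℕ} (hk : 2 ≤ k) {R : ℝ}
    {v : (Fin (k + 1) → ℝ) → ℝ} {D : (Fin (k + 1) → ℝ) → Fin (k + 1) → ℝ}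
    (hv : Continuous v) (hD : Continuous D)
    (hvD : ∀ x i, HasDerivAt (fun t => v (Function.update x i t)) (D x i) (x i))
    (hvR : ∀ x i, R ≤ |x i| → v x = 0) (hDR : ∀ x i, R ≤ |x i| → D x = 0)
    {N : ℝ} (hN : N = k + 1) :
    (∫ x, |v x| ^ (2 * N / (N - 2))) ^ (1 - 2 / N)
      ≤ (N * (N - 2) * Real.pi)⁻¹ * (Real.Gamma N / Real.Gamma (N / 2)) ^ (2 / N)
        * ∫ x, ∑ i, D x i ^ 2 := by
  have hN3 : 3 ≤ N := by
    have : (2 : ℝ) ≤ k := by exact_mod_cast hk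
    linarith
  have hN2 : 0 < N - 2 := by linarith
  have hNpos : 0 < N := by linarith
  have hk3 : 3 ≤ k + 1 := by omega
  have hcast : ((k + 1 : ℕ) : ℝ) = N := by rw [hN]; push_cast; rfl
  have hexp : 0 < 1 - 2 / N := by
    rw [sub_pos, div_lt_one hNpos]
    linarith
  set q : ℝ := 2 * N / (N - 2) with hq
  have hqpos : 0 < q := div_pos (by linarith) hN2
  set J : ℝ := ∫ x, |v x| ^ q with hJ
  set E : ℝ := ∫ x, ∑ i, D x i ^ 2 with hE
  have hE0 : 0 ≤ E := integral_nonneg fun y => Finset.sum_nonneg fun i _ => sq_nonneg _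
  have hJ0 : 0 ≤ J := integral_nonneg fun y => by positivity
  have hG1 : 0 < Real.Gamma N := Real.Gamma_pos_of_pos hNpos
  have hG2 : 0 < Real.Gamma (N / 2) := Real.Gamma_pos_of_pos (by linarith)
  have hpi := Real.pi_pos
  rcases hJ0.eq_or_lt with hJz | hJpos
  · rw [← hJz, Real.zero_rpow hexp.ne']
    positivity
  set A : ℝ := ∫ y, cauchyKernel (k + 1) y with hA
  have hAval : A = Real.pi ^ (N / 2) * Real.Gamma (N / 2) / Real.Gamma N := by
    rw [hA, integral_cauchyKernel k.succ_pos, hcast]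
  have hApos : 0 < A := by
    rw [hAval]
    positivity
  have hBval := integral_mul_cauchyKernel hk3
  have hCval := integral_sum_sq_mul_cauchyKernel hk3
  rw [hcast, ← hA] at hBval hCval
  set C : ℝ := ∫ y : Fin (k + 1) → ℝ, (∑ i, y i ^ 2) * cauchyKernel (k + 1) y with hC
  set a : ℝ := 2 * (N - 1) / (N - 2) with ha
  have hapos : 0 < a := div_pos (by linarith) hN2
  have hout : ∀ L, R ≤ L → ∀ x ∉ cube (k + 1) L, ∃ i, R ≤ |x i| := by
    intro L hRL x hx
    rw [mem_cube] at hx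
    push Not at hx
    obtain ⟨i, hi⟩ := hx
    refine ⟨i, hRL.trans ?_⟩
    by_contra! h
    exact hi (abs_le.1 h.le)
  have htrunc : ∀ L, max R 1 ≤ L →
      ∫ y in cube (k + 1) L, (1 + ∑ i, y i ^ 2) * cauchyKernel (k + 1) y
        ≤ (A / J) ^ (1 / 2 - 1 / N) * (a / N) * √(C * E) := by
    intro L hL
    have hRL : R ≤ L := (le_max_left _ _).trans hL
    have hLpos : 0 < L := one_pos.trans_le ((le_max_right _ _).trans hL)
    refine sobolev_truncated hk hLpos hv hD hvD (fun x i hx => hvR x i (hRL.trans hx)) hN ha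
      (setIntegral_le_integral (integrable_cauchyKernel k.succ_pos)
        (Eventually.of_forall fun y => (cauchyKernel_pos y).le))
      (setIntegral_le_integral (integrable_sum_sq_mul_cauchyKernel hk3)
        (Eventually.of_forall fun y => mul_nonneg (Finset.sum_nonneg fun i _ => sq_nonneg _)
          (cauchyKernel_pos y).le)) ?_ hJpos ?_
    · refine (setIntegral_eq_integral_of_forall_compl_eq_zero fun x hx => ?_).symm
      obtain ⟨i, hi⟩ := hout L hRL x hx
      rw [hvR x i hi, abs_zero, Real.zero_rpow hqpos.ne']
    · refine (setIntegral_eq_integral_of_forall_compl_eq_zero fun x hx => ?_).le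
      obtain ⟨i, hi⟩ := hout L hRL x hx
      simp [hDR x i hi]
  have hB : a * A ≤ (A / J) ^ (1 / 2 - 1 / N) * (a / N) * √(C * E) := by
    have hlim := tendsto_setIntegral_of_monotone
      (μ := (volume : Measure (Fin (k + 1) → ℝ))) (fun L => measurableSet_cube (k + 1) L)
      cube_mono (integrable_mul_cauchyKernel hk3).integrableOn
    rw [iUnion_cube, setIntegral_univ, hBval] at hlim
    exact le_of_tendsto hlim ((eventually_ge_atTop _).mono htrunc)
  have hCpos : 0 < C := by
    rw [hCval]
    positivity
  have hX : N * A ≤ (A / J) ^ (1 / 2 - 1 / N) * √(C * E) := by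
    have h1 : (A / J) ^ (1 / 2 - 1 / N) * (a / N) * √(C * E)
        = a / N * ((A / J) ^ (1 / 2 - 1 / N) * √(C * E)) := by ring
    have h2 : a * A = a / N * (N * A) := by field_simp
    rw [h1, h2] at hB
    exact le_of_mul_le_mul_left hB (by positivity)
  have hX2 : (N * A) ^ 2 ≤ (A / J) ^ (1 - 2 / N) * (C * E) := by
    have h1 := pow_le_pow_left₀ (by positivity) hX 2
    have h2 : ((A / J) ^ (1 / 2 - 1 / N)) ^ 2 = (A / J) ^ (1 - 2 / N) := by
      rw [← Real.rpow_natCast, ← Real.rpow_mul (by positivity)]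
      congr 1
      push_cast
      ring
    rwa [mul_pow _ (√(C * E)), Real.sq_sqrt (by positivity), h2] at h1
  rw [Real.div_rpow hApos.le hJ0, hCval, div_mul_eq_mul_div,
    le_div_iff₀ (Real.rpow_pos_of_pos hJpos _), Real.rpow_sub hApos, Real.rpow_one] at hX2
  have hA2 : A ^ (2 / N) = Real.pi * (Real.Gamma N / Real.Gamma (N / 2)) ^ (-(2 / N)) := by
    rw [hAval, mul_div_assoc, Real.mul_rpow (by positivity) (by positivity),
      ← Real.rpow_mul hpi.le, Real.rpow_neg (by positivity), ← Real.inv_rpow (by positivity),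
      inv_div, show N / 2 * (2 / N) = 1 by field_simp, Real.rpow_one]
  rw [hA2, Real.rpow_neg (by positivity)] at hX2
  have hGr : 0 < (Real.Gamma N / Real.Gamma (N / 2)) ^ (2 / N) := by positivity
  set γ := (Real.Gamma N / Real.Gamma (N / 2)) ^ (2 / N)
  have h3 : A / (Real.pi * γ⁻¹) * (N / (N - 2) * A * E)
      = (N * A) ^ 2 * ((N * (N - 2) * Real.pi)⁻¹ * γ * E) := by
    field_simp
  rw [h3] at hX2
  exact le_of_mul_le_mul_left hX2 (by positivity)

lemma sum_sq_apply_single_le {ι : Type*} [Fintype ι] [DecidableEq ι]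
    (T : EuclideanSpace ℝ ι →L[ℝ] ℝ) :
    ∑ i, T (EuclideanSpace.single i 1) ^ 2 ≤ ‖T‖ ^ 2 := by
  set z : EuclideanSpace ℝ ι := WithLp.toLp 2 fun i => T (EuclideanSpace.single i 1) with hz
  have hTz : T z = ∑ i, T (EuclideanSpace.single i 1) ^ 2 := by
    have h : z = ∑ i, z i • EuclideanSpace.single i (1 : ℝ) := by
      ext j
      simp [Pi.single_apply]
    rw [h, map_sum]
    simp [hz, sq]
  have hzn : ‖z‖ ^ 2 = ∑ i, T (EuclideanSpace.single i 1) ^ 2 := by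
    rw [EuclideanSpace.real_norm_sq_eq]
  have h := (le_abs_self _).trans (T.le_opNorm z)
  rw [hTz, ← hzn] at h
  rw [← hzn]
  rcases (norm_nonneg z).eq_or_lt with h0 | h0
  · rw [← h0, zero_pow two_ne_zero]
    positivity
  · have : ‖z‖ ≤ ‖T‖ := by nlinarith
    gcongr

lemma integrable_norm_fderiv_sq {E : Type*} [NormedAddCommGroup E] [NormedSpace ℝ E] [MeasurableSpace E]
    [OpensMeasurableSpace E] {μ : Measure E} [IsFiniteMeasureOnCompacts μ] {u : E → ℝ}
    (hu : ContDiff ℝ 1 u) (hsupp : HasCompactSupport u) :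
    Integrable (fun x => ‖fderiv ℝ u x‖ ^ 2) μ := by
  have h1 : Continuous fun x => ‖fderiv ℝ u x‖ ^ 2 :=
    (hu.continuous_fderiv one_ne_zero).norm.pow 2
  have h2 : HasCompactSupport fun x => ‖fderiv ℝ u x‖ ^ 2 :=
    (hsupp.fderiv ℝ).norm.comp_left (g := fun t : ℝ => t ^ 2) (zero_pow two_ne_zero)
  exact h1.integrable_of_hasCompactSupport h2

/-- The sharp Sobolev inequality on Euclidean space for compactly supported `C¹` functions. -/
theorem sharp_sobolev {n : ℕ} (hn : 3 ≤ n) {u : EuclideanSpace ℝ (Fin n) → ℝ}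
    (hu : ContDiff ℝ 1 u) (hsupp : HasCompactSupport u) :
    (∫ x, |u x| ^ (2 * n / ((n : ℝ) - 2))) ^ (1 - 2 / (n : ℝ))
      ≤ ((n : ℝ) * ((n : ℝ) - 2) * Real.pi)⁻¹
        * (Real.Gamma n / Real.Gamma ((n : ℝ) / 2)) ^ (2 / (n : ℝ))
        * ∫ x, ‖fderiv ℝ u x‖ ^ 2 := by
  obtain ⟨k, rfl⟩ : ∃ k, n = k + 1 := ⟨n - 1, by omega⟩
  have hcast : (3 : ℝ) ≤ ((k + 1 : ℕ) : ℝ) := by exact_mod_cast hn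
  generalize hN : ((k + 1 : ℕ) : ℝ) = N at hcast ⊢
  obtain ⟨R, hR⟩ := hsupp.isCompact.isBounded.subset_ball 0
  have hout : ∀ (x : Fin (k + 1) → ℝ) i, R ≤ |x i| → WithLp.toLp 2 x ∉ tsupport u := by
    intro x i hx h
    have h1 := mem_ball_zero_iff.1 (hR h)
    have h2 := PiLp.norm_apply_le (WithLp.toLp 2 x) i
    simp only [Real.norm_eq_abs] at h2
    linarith
  have hdc : Continuous (fderiv ℝ u) := hu.continuous_fderiv one_ne_zero
  have hLp : Continuous (WithLp.toLp 2 : (Fin (k + 1) → ℝ) → EuclideanSpace ℝ (Fin (k + 1))) :=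
    PiLp.continuous_toLp 2 _
  have h := sobolev_coordinates (k := k) (by omega) (R := R)
    (v := fun x => u (WithLp.toLp 2 x))
    (D := fun x i => fderiv ℝ u (WithLp.toLp 2 x) (EuclideanSpace.single i 1))
    (hu.continuous.comp hLp)
    (continuous_pi fun i => (hdc.comp hLp).clm_apply continuous_const)
    (fun x i => by
      have h1 := (hu.differentiable one_ne_zero (WithLp.toLp 2 x)).hasFDerivAt
      have h2 : HasDerivAt (fun t => WithLp.toLp 2 (Function.update x i t))
          (EuclideanSpace.single i (1 : ℝ)) (x i) := by
        have := (PiLp.hasFDerivAt_toLp (𝕜 := ℝ) 2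
          (Function.update x i (x i))).comp_hasDerivAt (x i) (hasDerivAt_update x i (x i))
        exact this
      exact HasFDerivAt.comp_hasDerivAt (x i) (by simpa using h1) h2)
    (fun x i hx => image_eq_zero_of_notMem_tsupport (hout x i hx))
    (fun x i hx => by
      ext j
      have : fderiv ℝ u (WithLp.toLp 2 x) = 0 := by
        by_contra h0
        exact hout x i hx (support_fderiv_subset ℝ h0)
      simp [this])
    (N := N) (by rw [← hN, Nat.cast_succ])
  have hmp := PiLp.volume_preserving_toLp (Fin (k + 1))
  have hme := (MeasurableEquiv.toLp 2 (Fin (k + 1) → ℝ)).measurableEmbedding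
  have e1 := hmp.integral_comp hme fun x => |u x| ^ (2 * N / (N - 2))
  have e2 := hmp.integral_comp hme fun x =>
    ∑ i, fderiv ℝ u x (EuclideanSpace.single i 1) ^ 2
  rw [e1, e2] at h
  refine h.trans ?_
  have hpi := Real.pi_pos
  have hG1 : 0 < Real.Gamma N := Real.Gamma_pos_of_pos (by linarith)
  have hG2 : 0 < Real.Gamma (N / 2) := Real.Gamma_pos_of_pos (by linarith)
  have hS : 0 < N * (N - 2) * Real.pi :=
    mul_pos (mul_pos (by linarith) (by linarith)) hpi
  refine mul_le_mul_of_nonneg_left ?_ (by positivity)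
  have hint := integrable_norm_fderiv_sq (μ := volume) hu hsupp
  have hnn : ∀ x, 0 ≤ ∑ i, fderiv ℝ u x (EuclideanSpace.single i 1) ^ 2 := fun x =>
    Finset.sum_nonneg fun i _ => sq_nonneg _
  have hle : ∀ x, ∑ i, fderiv ℝ u x (EuclideanSpace.single i 1) ^ 2 ≤ ‖fderiv ℝ u x‖ ^ 2 :=
    fun x => sum_sq_apply_single_le _
  exact integral_mono_of_nonneg (Eventually.of_forall hnn) hint (Eventually.of_forall hle)

/-- Hölder's inequality for `|u| ^ r * w`, with the exponents of the weighted Sobolev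
inequality. -/
lemma setIntegral_rpow_mul_le {α : Type*} [MeasurableSpace α] {μ : Measure α} {U : Set α}
    {u w : α → ℝ} {p q r : ℝ} (hp : 1 < p) (hr : r = q * (1 - 1 / p)) (hrpos : 0 < r)
    (hu : AEStronglyMeasurable u μ) (huq : Integrable (fun x => |u x| ^ q) μ)
    (hw : AEStronglyMeasurable w μ) (hw0 : ∀ x, 0 ≤ w x)
    (hwp : IntegrableOn (fun x => w x ^ p) U μ) :
    (∫ x in U, |u x| ^ r * w x ∂μ) ^ (2 / r)
      ≤ (∫ x, |u x| ^ q ∂μ) ^ (2 / q) * (∫ x in U, w x ^ p ∂μ) ^ (2 / (r * p)) := by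
  have hp0 : 0 < p := one_pos.trans hp
  have hconj : (p.conjExponent).HolderConjugate p := (Real.HolderConjugate.conjExponent hp).symm
  set p' := p.conjExponent with hp'
  have hp'0 : 0 < p' := hconj.pos
  have hinv : 1 / p' = 1 - 1 / p := by
    have := hconj.inv_add_inv_eq_one
    rw [one_div, one_div]
    linarith
  have hrp : r * p' = q := by
    rw [hr, ← hinv]
    field_simp
  have hq0 : 0 < q := hrp ▸ mul_pos hrpos hp'0
  have hpow : ∀ x, (|u x| ^ r) ^ p' = |u x| ^ q := fun x => by
    rw [← Real.rpow_mul (abs_nonneg _), hrp]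
  have hum : AEStronglyMeasurable (fun x => |u x| ^ r) (μ.restrict U) :=
    (hu.aemeasurable.abs.pow_const r).aestronglyMeasurable.restrict
  have h1 : MemLp (fun x => |u x| ^ r) (ENNReal.ofReal p') (μ.restrict U) := by
    rw [← integrable_norm_rpow_iff hum (by simpa using hp'0) ENNReal.ofReal_ne_top,
      ENNReal.toReal_ofReal hp'0.le]
    refine (huq.restrict (s := U)).congr (Eventually.of_forall fun x => ?_)
    simp only
    rw [Real.norm_of_nonneg (by positivity), hpow]
  have h2 : MemLp w (ENNReal.ofReal p) (μ.restrict U) := by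
    rw [← integrable_norm_rpow_iff hw.restrict (by simpa using hp0) ENNReal.ofReal_ne_top,
      ENNReal.toReal_ofReal hp0.le]
    refine hwp.congr (Eventually.of_forall fun x => ?_)
    simp only
    rw [Real.norm_of_nonneg (hw0 x)]
  have h := integral_mul_le_Lp_mul_Lq_of_nonneg hconj
    (Eventually.of_forall fun x => by positivity) (Eventually.of_forall hw0) h1 h2
  simp only [hpow] at h
  have hI0 : 0 ≤ ∫ x in U, |u x| ^ q ∂μ := integral_nonneg fun x => by positivity
  have hW0 : 0 ≤ ∫ x in U, w x ^ p ∂μ := integral_nonneg fun x => by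
    have := hw0 x
    positivity
  have hL0 : 0 ≤ ∫ x in U, |u x| ^ r * w x ∂μ := integral_nonneg fun x => by
    have := hw0 x
    positivity
  have hUle : ∫ x in U, |u x| ^ q ∂μ ≤ ∫ x, |u x| ^ q ∂μ :=
    setIntegral_le_integral huq (Eventually.of_forall fun x => by positivity)
  have h' := Real.rpow_le_rpow hL0 h (z := 2 / r) (by positivity)
  rw [Real.mul_rpow (by positivity) (by positivity), ← Real.rpow_mul hI0, ← Real.rpow_mul hW0,
    show 1 / p' * (2 / r) = 2 / q by rw [← hrp]; field_simp,
    show 1 / p * (2 / r) = 2 / (r * p) by field_simp] at h'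
  refine h'.trans ?_
  gcongr

end

/-- Lemma 5.1: the weighted Sobolev inequality
`‖u‖²_{L^r(U, w·dx)} ≤ S_n ‖w‖_{L^p(U)}^{2/r} · ∫_U ‖∇u‖²`
for `n ≥ 3`, `p > n/2`, `n* = 2n/(n-2)`, `r = n*(1 - 1/p)`, where `S_n` is the
sharp Sobolev constant in `ℝⁿ`. -/
theorem weighted_sobolev_inequality
    (n : ℕ) (hn : 3 ≤ n)
    (U : Set (EuclideanSpace ℝ (Fin n)))
    (hU : IsOpen U)
    (p : ℝ) (hp : (n : ℝ) / 2 < p)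
    (nstar r Sn : ℝ)
    (hnstar : nstar = 2 * n / ((n : ℝ) - 2))
    (hr : r = nstar * (1 - 1 / p))
    (hSn : Sn = ((n : ℝ) * ((n : ℝ) - 2) * Real.pi)⁻¹
      * (Real.Gamma n / Real.Gamma ((n : ℝ) / 2)) ^ ((2 : ℝ) / n))
    (w : EuclideanSpace ℝ (Fin n) → ℝ)
    (hwmeas : Measurable w) (hwnn : ∀ x, 0 ≤ w x)
    (hwp : IntegrableOn (fun x => w x ^ p) U)
    (u : EuclideanSpace ℝ (Fin n) → ℝ)
    (hu : ContDiff ℝ (⊤ : ℕ∞) u) (hsupp : HasCompactSupport u) (hUsupp : tsupport u ⊆ U) :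
    (∫ x in U, |u x| ^ r * w x) ^ ((2 : ℝ) / r)
      ≤ Sn * (∫ x in U, w x ^ p) ^ ((2 : ℝ) / (r * p))
        * ∫ x in U, ‖fderiv ℝ u x‖ ^ 2 := by

  have hn3 : (3 : ℝ) ≤ n := by exact_mod_cast hn
  have hn2 : 0 < (n : ℝ) - 2 := by linarith
  have hp1 : 1 < p := by linarith
  have hns : 0 < nstar := hnstar ▸ div_pos (by linarith) hn2
  have hrpos : 0 < r := by
    rw [hr]
    refine mul_pos hns (sub_pos.2 ?_)
    rw [div_lt_one (by linarith)]
    exact hp1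
  have hgrad : ∫ x in U, ‖fderiv ℝ u x‖ ^ 2 = ∫ x, ‖fderiv ℝ u x‖ ^ 2 := by
    refine setIntegral_eq_integral_of_forall_compl_eq_zero fun x hx => ?_
    have : fderiv ℝ u x = 0 := by
      by_contra h
      exact hx (hUsupp (support_fderiv_subset ℝ h))
    simp [this]
  have huq : Integrable fun x => |u x| ^ nstar :=
    (hu.continuous.abs.rpow_const fun x => Or.inr hns.le).integrable_of_hasCompactSupport
      (hsupp.comp_left (g := fun t => |t| ^ nstar) (by simp [Real.zero_rpow hns.ne']))
  have hsob := sharp_sobolev hn (hu.of_le (by exact_mod_cast le_top)) hsupp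
  have hexp : 1 - 2 / (n : ℝ) = 2 / nstar := by
    rw [hnstar]
    field_simp
  rw [← hnstar, ← hSn, hexp] at hsob
  have hW0 : 0 ≤ ∫ x in U, w x ^ p := integral_nonneg fun x => Real.rpow_nonneg (hwnn x) p
  refine (setIntegral_rpow_mul_le hp1 hr hrpos hu.continuous.aestronglyMeasurable huq
    hwmeas.aestronglyMeasurable hwnn hwp).trans ?_
  rw [hgrad, mul_right_comm]
  exact mul_le_mul_of_nonneg_right hsob (Real.rpow_nonneg hW0 _)
end

section
/- Let n ≥ 3, let Ω ⊆ ℝⁿ be open, let V : Ω → ℝ be measurable, let e ∈ ℝ, set U_e := {x ∈ Ω : V(x) < e} and w := (V − e)_- = max(e − V, 0). Let p ∈ (n/2, ∞), assume ∫_Ω w dx < ∞ and ∫_Ω w^p dx < ∞, set n* := 2n/(n − 2), r := n*·(1 − 1/p), d := 2r/(r − 2), and S_n := (n(n − 2)π)^{-1}·(Γ(n)/Γ(n/2))^{2/n}. Then for every λ ≥ 0 and every finite-dimensional subspace M of the space of smooth compactly supported functions with support in U_e such that every u ∈ M satisfies ∫_{U_e} ‖∇u‖² dx ≤ λ · ∫_{U_e}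 |u|² · w dx, one has dim M ≤ e^{2d} · S_n^d · (∫_{U_e} w dx)² · (∫_{U_e} w^p dx)^{(d−2)/p} · λ^d. -/
open MeasureTheory

section Fourier

open scoped FourierTransform ENNReal SchwartzMap

theorem measurableSet_le_norm {E : Type*} [NormedAddCommGroup E] [MeasurableSpace E]
    [OpensMeasurableSpace E] (κ : ℝ) : MeasurableSet {ξ : E | κ ≤ ‖ξ‖} :=
  measurableSet_le measurable_const measurable_norm

variable {E : Type*} [NormedAddCommGroup E] [InnerProductSpace ℝ E] [FiniteDimensional ℝ E]
  [MeasurableSpace E] [BorelSpace E]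

/-- Plancherel for integrable square-integrable functions and the Fourier integral. -/
theorem lintegral_enorm_sq_fourier {g : E → ℂ} (h1 : Integrable g) (h2 : MemLp g 2) :
    ∫⁻ x, ‖𝓕 g x‖ₑ ^ 2 = ∫⁻ x, ‖g x‖ₑ ^ 2 := by
  have hcont : Continuous (𝓕 g) :=
    VectorFourier.fourierIntegral_continuous Real.continuous_fourierChar
      continuous_inner h1
  have hae : ∀ᵐ x, (𝓕 (h2.toLp g) : Lp ℂ 2 (volume : Measure E)) x = 𝓕 g x := by
    refine ae_eq_of_integral_contDiff_smul_eq
      ((Lp.memLp (𝓕 (h2.toLp g))).locallyIntegrable (by norm_num))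
      hcont.locallyIntegrable fun φ hφ hφc => ?_
    let ψ : 𝓢(E, ℂ) := HasCompactSupport.toSchwartzMap (f := fun x => (φ x : ℂ))
      (hφc.comp_left Complex.ofReal_zero) (Complex.ofRealCLM.contDiff.comp hφ)
    have e1 := congrArg (fun T => T ψ) (Lp.fourier_toTemperedDistribution_eq (h2.toLp g))
    simp only [TemperedDistribution.fourier_apply, Lp.toTemperedDistribution_apply] at e1
    have e2 : ∫ x, 𝓕 ψ x • (h2.toLp g) x = ∫ x, 𝓕 ψ x • g x := by
      refine integral_congr_ae ?_
      filter_upwards [h2.coeFn_toLp] with x hx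
      rw [hx]
    have e3 : ∫ x, 𝓕 ψ x • g x = ∫ x, ψ x • 𝓕 g x := by
      simpa using! (VectorFourier.integral_fourierIntegral_smul_eq_flip (L := innerₗ E)
        Real.continuous_fourierChar continuous_inner ψ.integrable h1)
    rw [e2, e3] at e1
    simpa [ψ, Complex.real_smul] using! e1.symm
  have hn := Lp.norm_fourier_eq (h2.toLp g)
  have hn' : eLpNorm (𝓕 g) 2 volume = eLpNorm g 2 volume := by
    rw [← eLpNorm_congr_ae hae, ← eLpNorm_congr_ae h2.coeFn_toLp]
    rw [Lp.norm_def, Lp.norm_def, ENNReal.toReal_eq_toReal_iff' (Lp.eLpNorm_ne_top _)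
      (Lp.eLpNorm_ne_top _)] at hn
    exact hn
  refine ENNReal.rpow_left_injective (x := 2⁻¹) (by norm_num) ?_
  simpa [eLpNorm_eq_lintegral_rpow_enorm_toReal] using hn'

/-- The part of `𝓕 g` carried by the frequencies of norm at least `κ`. -/
noncomputable def highFreq (κ : ℝ) (g : E → ℂ) : E → ℂ :=
  𝓕 ({ξ | κ ≤ ‖ξ‖}.indicator g)

theorem lintegral_enorm_sq_highFreq (κ : ℝ) (g : 𝓢(E, ℂ)) :
    ∫⁻ x, ‖highFreq κ g x‖ₑ ^ 2 = ∫⁻ ξ in {ξ | κ ≤ ‖ξ‖}, ‖g ξ‖ₑ ^ 2 := by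
  rw [highFreq, lintegral_enorm_sq_fourier (g.integrable.indicator (measurableSet_le_norm κ))
    ((g.memLp 2 volume).indicator (measurableSet_le_norm κ)),
    ← lintegral_indicator (measurableSet_le_norm κ)]
  congr 1 with ξ
  by_cases h : ξ ∈ {ξ : E | κ ≤ ‖ξ‖} <;> simp [h]

theorem highFreq_sum_smul {ι : Type*} (s : Finset ι) (κ : ℝ) (c : ι → ℝ) (g : ι → 𝓢(E, ℂ))
    (x : E) :
    highFreq κ (∑ j ∈ s, c j • g j : 𝓢(E, ℂ)) x = ∑ j ∈ s, c j * highFreq κ (g j) x := by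
  simp only [highFreq, Real.fourier_eq]
  simp_rw [← integral_const_mul]
  rw [← integral_finsetSum]
  · congr 1 with ξ
    by_cases h : κ ≤ ‖ξ‖ <;>
      simp [h, sum_apply, Finset.smul_sum, Circle.smul_def]
    exact Finset.sum_congr rfl fun _ _ => by ring
  · intro j _
    exact ((Real.fourierIntegral_convergent_iff x).2
      ((g j).integrable.indicator (measurableSet_le_norm κ))).const_mul _

theorem measurable_highFreq (g : 𝓢(E, ℂ)) :
    Measurable fun q : ℝ × E => highFreq q.1 g q.2 := by
  simp only [highFreq, Real.fourier_eq]
  refine (StronglyMeasurable.integral_prod_right' (f := fun q : (ℝ × E) × E =>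
    Real.fourierChar (-inner ℝ q.2 q.1.2) • {ξ : E | q.1.1 ≤ ‖ξ‖}.indicator g q.2) ?_).measurable
  have h1 : Continuous fun q : (ℝ × E) × E => Real.fourierChar (-inner ℝ q.2 q.1.2) := by
    have := Real.continuous_fourierChar
    fun_prop
  have h2 : StronglyMeasurable fun q : (ℝ × E) × E => {ξ : E | q.1.1 ≤ ‖ξ‖}.indicator g q.2 := by
    have : (fun q : (ℝ × E) × E => {ξ : E | q.1.1 ≤ ‖ξ‖}.indicator g q.2)
        = {q : (ℝ × E) × E | q.1.1 ≤ ‖q.2‖}.indicator fun q => g q.2 := by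
      ext q; rfl
    rw [this]
    exact ((g.continuous.comp continuous_snd).stronglyMeasurable).indicator
      (measurableSet_le (by fun_prop) (by fun_prop))
  exact h1.stronglyMeasurable.smul h2

/-- The frequencies of norm less than `κ` are controlled pointwise by the Dirichlet integral. -/
theorem enorm_sq_fourier_sub_highFreq_le [Nontrivial E] (κ : ℝ) (g : 𝓢(E, ℂ)) (x : E) :
    ‖𝓕 g x - highFreq κ g x‖ₑ ^ 2
      ≤ (∫⁻ ξ in Metric.ball (0 : E) κ, ENNReal.ofReal ((2 * Real.pi * ‖ξ‖) ^ (-2 : ℤ)))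
        * ∫⁻ ξ, ENNReal.ofReal ((2 * Real.pi * ‖ξ‖) ^ 2) * ‖g ξ‖ₑ ^ 2 := by
  have e1 : 𝓕 g x - highFreq κ g x
      = ∫ ξ in Metric.ball (0 : E) κ, Real.fourierChar (-inner ℝ ξ x) • g ξ := by
    rw [SchwartzMap.fourier_coe, highFreq, Real.fourier_eq, Real.fourier_eq, ← integral_sub,
      ← integral_indicator Metric.isOpen_ball.measurableSet]
    · congr 1 with ξ
      by_cases h : κ ≤ ‖ξ‖
      · simp [h, not_lt.2 h]
      · simp [h, not_le.1 h]
    · exact (Real.fourierIntegral_convergent_iff x).2 g.integrable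
    · exact (Real.fourierIntegral_convergent_iff x).2
        (g.integrable.indicator (measurableSet_le_norm κ))
  have e2 : ‖𝓕 g x - highFreq κ g x‖ₑ ≤ ∫⁻ ξ in Metric.ball (0 : E) κ,
      ENNReal.ofReal ((2 * Real.pi * ‖ξ‖)⁻¹) * (ENNReal.ofReal (2 * Real.pi * ‖ξ‖) * ‖g ξ‖ₑ) := by
    rw [e1]
    refine (enorm_integral_le_lintegral_enorm _).trans (lintegral_mono_ae ?_)
    filter_upwards [ae_restrict_of_ae (Measure.ae_ne volume (0 : E))] with ξ hξ
    have hpos : 0 < 2 * Real.pi * ‖ξ‖ := by have := norm_pos_iff.2 hξ; positivity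
    rw [← mul_assoc, ← ENNReal.ofReal_mul (by positivity), inv_mul_cancel₀ hpos.ne']
    simp [← ofReal_norm, Circle.norm_smul]
  have e3 := ENNReal.lintegral_mul_le_Lp_mul_Lq (volume.restrict (Metric.ball (0 : E) κ))
    Real.HolderConjugate.two_two
    (f := fun ξ => ENNReal.ofReal ((2 * Real.pi * ‖ξ‖)⁻¹))
    (g := fun ξ => ENNReal.ofReal (2 * Real.pi * ‖ξ‖) * ‖g ξ‖ₑ)
    (by fun_prop) (by have := g.continuous; fun_prop)
  have e4 := pow_le_pow_left' (e2.trans e3) 2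
  refine e4.trans ?_
  rw [mul_pow, ← ENNReal.rpow_natCast, ← ENNReal.rpow_natCast, ← ENNReal.rpow_mul,
    ← ENNReal.rpow_mul, show (1 / 2 : ℝ) * (2 : ℕ) = 1 by norm_num, ENNReal.rpow_one,
    ENNReal.rpow_one]
  simp_rw [ENNReal.rpow_two]
  refine mul_le_mul' (le_of_eq ?_) ?_
  · congr 1 with ξ
    rw [← ENNReal.ofReal_pow (by positivity)]
    congr 1
    rw [zpow_neg]
    norm_cast
    field_simp
  · refine (setLIntegral_le_lintegral _ _).trans (le_of_eq ?_)
    congr 1 with ξ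
    rw [mul_pow, ← ENNReal.ofReal_pow (by positivity)]

theorem lintegral_ball_norm_zpow (h3 : 3 ≤ Module.finrank ℝ E) {κ : ℝ} (hκ : 0 < κ) :
    ∫⁻ ξ in Metric.ball (0 : E) κ, ENNReal.ofReal ((2 * Real.pi * ‖ξ‖) ^ (-2 : ℤ))
      = ENNReal.ofReal (Module.finrank ℝ E * volume.real (Metric.ball (0 : E) 1)
        / (4 * Real.pi ^ 2 * (Module.finrank ℝ E - 2)) * κ ^ (Module.finrank ℝ E - 2)) := by
  have : Nontrivial E := Module.nontrivial_of_finrank_pos (R := ℝ) (by omega)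
  obtain ⟨m, hm⟩ := Nat.exists_eq_add_of_le h3
  have hpt : ∀ y ∈ Set.Ioo 0 κ, y ^ (Module.finrank ℝ E - 1) • (2 * Real.pi * y) ^ (-2 : ℤ)
      = (4 * Real.pi ^ 2)⁻¹ * y ^ (m : ℕ) := by
    intro y hy
    have hy0 : y ≠ 0 := hy.1.ne'
    rw [hm, show 3 + m - 1 = m + 2 by omega, zpow_neg, pow_add, smul_eq_mul]
    norm_cast
    field_simp
    ring
  have hint : IntegrableOn (fun ξ : E => (2 * Real.pi * ‖ξ‖) ^ (-2 : ℤ)) (Metric.ball 0 κ) := by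
    rw [integrableOn_fun_norm_addHaar volume (f := fun y => (2 * Real.pi * y) ^ (-2 : ℤ))]
    refine IntegrableOn.congr_fun ?_ (fun y hy => (hpt y hy).symm) measurableSet_Ioo
    exact (Continuous.integrableOn_Icc (by fun_prop)).mono_set Set.Ioo_subset_Icc_self
  rw [← ofReal_integral_eq_lintegral_ofReal hint (Filter.Eventually.of_forall fun _ => by
    positivity), ← integral_indicator Metric.isOpen_ball.measurableSet]
  have e1 : (Metric.ball (0 : E) κ).indicator (fun ξ : E => (2 * Real.pi * ‖ξ‖) ^ (-2 : ℤ))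
      = fun ξ => (Set.Iio κ).indicator (fun y : ℝ => (2 * Real.pi * y) ^ (-2 : ℤ)) ‖ξ‖ := by
    ext ξ
    simp [Set.indicator]
  have e2 : ∫ y in Set.Ioi (0 : ℝ), y ^ (Module.finrank ℝ E - 1) •
      (Set.Iio κ).indicator (fun y : ℝ => (2 * Real.pi * y) ^ (-2 : ℤ)) y
      = (4 * Real.pi ^ 2)⁻¹ * (κ ^ (m + 1) / (m + 1)) := by
    calc _ = ∫ y in Set.Ioi (0 : ℝ), (Set.Iio κ).indicator
          (fun y : ℝ => y ^ (Module.finrank ℝ E - 1) • (2 * Real.pi * y) ^ (-2 : ℤ)) y := by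
          congr 1 with y
          by_cases h : y < κ <;> simp [h]
      _ = ∫ y in Set.Ioo 0 κ, y ^ (Module.finrank ℝ E - 1) • (2 * Real.pi * y) ^ (-2 : ℤ) := by
          rw [setIntegral_indicator measurableSet_Iio, Set.Ioi_inter_Iio]
      _ = ∫ y in Set.Ioo 0 κ, (4 * Real.pi ^ 2)⁻¹ * y ^ (m : ℕ) :=
          setIntegral_congr_fun measurableSet_Ioo hpt
      _ = _ := by
          rw [integral_const_mul, ← integral_Ioc_eq_integral_Ioo,
            ← intervalIntegral.integral_of_le hκ.le, integral_pow]
          simp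
  rw [e1, integral_fun_norm_addHaar volume, e2, hm, show 3 + m - 2 = m + 1 by omega]
  congr 1
  simp only [nsmul_eq_mul, smul_eq_mul]
  push_cast
  have : (3 + (m : ℝ) - 2) ≠ 0 := by
    have : (0 : ℝ) ≤ m := by positivity
    linarith
  field_simp
  ring

theorem lintegral_Ioc_ofReal {b : ℝ} (hb : 0 ≤ b) :
    ∫⁻ κ in Set.Ioc 0 b, ENNReal.ofReal κ = ENNReal.ofReal (b ^ 2 / 2) := by
  rw [← ofReal_integral_eq_lintegral_ofReal, ← intervalIntegral.integral_of_le hb, integral_id]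
  · simp
  · exact (Continuous.integrableOn_Icc (by fun_prop)).mono_set Set.Ioc_subset_Icc_self
  · exact (ae_restrict_mem measurableSet_Ioc).mono fun κ h => h.1.le

theorem lintegral_lintegral_highFreq (g : 𝓢(E, ℂ)) :
    ∫⁻ x, ∫⁻ κ in Set.Ioi (0 : ℝ), ENNReal.ofReal κ * ‖highFreq κ g x‖ₑ ^ 2
      = ∫⁻ ξ, ENNReal.ofReal (‖ξ‖ ^ 2 / 2) * ‖g ξ‖ₑ ^ 2 := by
  have hm := measurable_highFreq g
  have hg := g.continuous
  have hset : MeasurableSet {q : ℝ × E | q.1 ≤ ‖q.2‖} :=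
    measurableSet_le (by fun_prop) (by fun_prop)
  have e1 : ∀ κ : ℝ, ENNReal.ofReal κ * (∫⁻ x, ‖highFreq κ g x‖ₑ ^ 2)
      = ∫⁻ ξ, {q : ℝ × E | q.1 ≤ ‖q.2‖}.indicator
        (fun q => ENNReal.ofReal q.1 * ‖g q.2‖ₑ ^ 2) (κ, ξ) := by
    intro κ
    rw [lintegral_enorm_sq_highFreq, ← lintegral_indicator (measurableSet_le_norm κ),
      ← lintegral_const_mul]
    · congr 1 with ξ
      by_cases h : κ ≤ ‖ξ‖ <;> simp [h]
    · exact Measurable.indicator (by fun_prop) (measurableSet_le_norm κ)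
  have e2 : ∀ ξ : E, ∫⁻ κ in Set.Ioi (0 : ℝ), {q : ℝ × E | q.1 ≤ ‖q.2‖}.indicator
      (fun q => ENNReal.ofReal q.1 * ‖g q.2‖ₑ ^ 2) (κ, ξ)
      = ENNReal.ofReal (‖ξ‖ ^ 2 / 2) * ‖g ξ‖ₑ ^ 2 := by
    intro ξ
    calc _ = ∫⁻ κ in Set.Ioi (0 : ℝ), (Set.Iic ‖ξ‖).indicator
          (fun κ => ENNReal.ofReal κ * ‖g ξ‖ₑ ^ 2) κ := by
          congr 1 with κ
      _ = ∫⁻ κ in Set.Ioc 0 ‖ξ‖, ENNReal.ofReal κ * ‖g ξ‖ₑ ^ 2 := by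
          rw [setLIntegral_indicator measurableSet_Iic, Set.inter_comm, Set.Ioi_inter_Iic]
      _ = _ := by
          rw [lintegral_mul_const _ (by fun_prop), lintegral_Ioc_ofReal (norm_nonneg ξ)]
  rw [lintegral_lintegral_swap]
  · calc _ = ∫⁻ κ in Set.Ioi (0 : ℝ), ∫⁻ ξ, {q : ℝ × E | q.1 ≤ ‖q.2‖}.indicator
          (fun q => ENNReal.ofReal q.1 * ‖g q.2‖ₑ ^ 2) (κ, ξ) := by
          congr 1 with κ
          rw [← e1, lintegral_const_mul]
          exact (hm.comp measurable_prodMk_left).enorm.pow_const 2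
      _ = _ := by
          rw [lintegral_lintegral_swap]
          · simp_rw [e2]
          · exact (Measurable.indicator
              (measurable_fst.ennreal_ofReal.mul
                ((hg.measurable.comp measurable_snd).enorm.pow_const 2)) hset).aemeasurable
  · refine Measurable.aemeasurable ?_
    have := hm.comp measurable_swap
    simp only [Function.comp_def, Prod.fst_swap, Prod.snd_swap] at this
    exact (by fun_prop : Measurable fun q : E × ℝ => ENNReal.ofReal q.2).mul
      (this.enorm.pow_const 2)

/-- Plancherel for the gradient of a real-valued function. -/
theorem lintegral_enorm_sq_fderiv {f : E → ℝ} (hf : Differentiable ℝ f) (F : 𝓢(E, ℂ))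
    (hF : ∀ x, F x = f x) :
    ∫⁻ ξ, ENNReal.ofReal ((2 * Real.pi * ‖ξ‖) ^ 2) * ‖(𝓕⁻ F) ξ‖ₑ ^ 2
      = ∫⁻ x, ‖fderiv ℝ f x‖ₑ ^ 2 := by
  let b := stdOrthonormalBasis ℝ E
  have hd : ∀ i x, (LineDeriv.lineDerivOp (b i) F) x = (fderiv ℝ f x (b i) : ℂ) := by
    intro i x
    have h1 : HasFDerivAt (fun y => (f y : ℂ)) (Complex.ofRealCLM.comp (fderiv ℝ f x)) x :=
      Complex.ofRealCLM.hasFDerivAt.comp x (hf x).hasFDerivAt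
    have h2 : (F : E → ℂ) = fun y => (f y : ℂ) := funext hF
    rw [SchwartzMap.lineDerivOp_apply_eq_fderiv, h2, h1.fderiv]
    rfl
  have hi : ∀ i, ∫⁻ x, ‖fderiv ℝ f x (b i)‖ₑ ^ 2
      = ∫⁻ ξ, ENNReal.ofReal ((2 * Real.pi * inner ℝ ξ (b i)) ^ 2) * ‖(𝓕⁻ F) ξ‖ₑ ^ 2 := by
    intro i
    have h1 := lintegral_enorm_sq_fourier (𝓕⁻ (LineDeriv.lineDerivOp (b i) F)).integrable
      ((𝓕⁻ (LineDeriv.lineDerivOp (b i) F)).memLp 2 volume)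
    rw [← SchwartzMap.fourier_coe, FourierTransform.fourier_fourierInv_eq] at h1
    have ht : (inner ℝ · (b i)).HasTemperateGrowth := by fun_prop
    calc _ = ∫⁻ x, ‖(LineDeriv.lineDerivOp (b i) F) x‖ₑ ^ 2 := by
          simp_rw [hd]; congr 1 with x; simp [enorm_eq_nnnorm]
      _ = _ := h1
      _ = _ := by
          congr 1 with ξ
          rw [SchwartzMap.fourierInv_lineDerivOp_eq]
          simp only [smul_apply, SchwartzMap.smulLeftCLM_apply_apply ht, ← ofReal_norm]
          rw [← ENNReal.ofReal_pow (by positivity), ← ENNReal.ofReal_pow (by positivity),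
            ← ENNReal.ofReal_mul (by positivity)]
          congr 1
          simp [mul_pow, abs_of_pos Real.pi_pos]
          ring
  have hs1 : ∀ x, ‖fderiv ℝ f x‖ₑ ^ 2 = ∑ i, ‖fderiv ℝ f x (b i)‖ₑ ^ 2 := by
    intro x
    have h1 := b.sum_sq_norm_inner_left ((InnerProductSpace.toDual ℝ E).symm (fderiv ℝ f x))
    simp only [InnerProductSpace.toDual_symm_apply, LinearIsometryEquiv.norm_map] at h1
    simp_rw [← ofReal_norm]
    rw [← ENNReal.ofReal_pow (by positivity), ← h1, ENNReal.ofReal_sum_of_nonneg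
      (fun _ _ => by positivity)]
    exact Finset.sum_congr rfl fun i _ => by rw [← ENNReal.ofReal_pow (by positivity)]
  have hs2 : ∀ ξ : E, ENNReal.ofReal ((2 * Real.pi * ‖ξ‖) ^ 2)
      = ∑ i, ENNReal.ofReal ((2 * Real.pi * inner ℝ ξ (b i)) ^ 2) := by
    intro ξ
    have h1 := b.sum_sq_norm_inner_left ξ
    rw [← ENNReal.ofReal_sum_of_nonneg (fun _ _ => by positivity)]
    simp_rw [mul_pow, ← Finset.mul_sum]
    rw [← h1]
    simp
  simp_rw [hs1, hs2, Finset.sum_mul]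
  have hc := (𝓕⁻ F).continuous
  rw [lintegral_finsetSum _ (fun i _ => by fun_prop),
    lintegral_finsetSum _ (fun i _ => by fun_prop)]
  exact Finset.sum_congr rfl fun i _ => (hi i).symm

/-- Where the density `ρ = ∑ u j ^ 2` of a Dirichlet-orthonormal family is large, at least a quarter
of it is carried by high frequencies. -/
theorem sum_sq_le_highFreq [Nontrivial E] {ι : Type*} [Fintype ι] {u : ι → E → ℝ}
    (hu : ∀ j, Differentiable ℝ (u j)) {F : ι → 𝓢(E, ℂ)} (hF : ∀ j x, F j x = u j x)
    (horth : ∀ c : ι → ℝ, ∫⁻ x, ‖fderiv ℝ (fun y => ∑ j, c j * u j y) x‖ₑ ^ 2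
      = ENNReal.ofReal (∑ j, c j ^ 2))
    {κ a : ℝ} (ha : 0 ≤ a)
    (hball : ∫⁻ ξ in Metric.ball (0 : E) κ, ENNReal.ofReal ((2 * Real.pi * ‖ξ‖) ^ (-2 : ℤ))
      = ENNReal.ofReal a)
    (x : E) (hx : 4 * a ≤ ∑ j, u j x ^ 2) :
    ENNReal.ofReal (∑ j, u j x ^ 2) ≤ 4 * ∑ j, ‖highFreq κ (𝓕⁻ (F j) : 𝓢(E, ℂ)) x‖ₑ ^ 2 := by
  set ρ := ∑ j, u j x ^ 2 with hρ
  have hρ0 : 0 ≤ ρ := Finset.sum_nonneg fun _ _ => sq_nonneg _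
  set c : ι → ℝ := fun j => u j x with hc
  set H : 𝓢(E, ℂ) := ∑ j, c j • F j with hH
  have hHx : ∀ y, H y = ((∑ j, c j * u j y : ℝ) : ℂ) := by
    intro y
    simp [hH, sum_apply, hF]
  have hinv : 𝓕⁻ H = ∑ j, c j • 𝓕⁻ (F j) := by
    simp only [hH]
    simp
  have hlow := enorm_sq_fourier_sub_highFreq_le κ (𝓕⁻ H) x
  rw [FourierTransform.fourier_fourierInv_eq, hHx, hball,
    lintegral_enorm_sq_fderiv (Differentiable.fun_sum fun j _ => (hu j).const_mul (c j)) H hHx,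
    horth, hinv, highFreq_sum_smul] at hlow
  have hcs : ∑ j, c j * u j x = ρ := by simp only [hρ, hc, sq]
  rw [hcs, ← hρ, ← ofReal_norm, ← ENNReal.ofReal_pow (by positivity), ← ENNReal.ofReal_mul ha,
    ENNReal.ofReal_le_ofReal_iff (by positivity)] at hlow
  set h : ι → ℂ := fun j => highFreq κ (𝓕⁻ (F j) : 𝓢(E, ℂ)) x with hh
  have h1 : ‖(ρ : ℂ) - ∑ j, c j * h j‖ ≤ ρ / 2 := by
    refine abs_le_of_sq_le_sq' ?_ (by positivity) |>.2
    nlinarith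
  have h2 : ρ ≤ ‖(ρ : ℂ) - ∑ j, c j * h j‖ + ‖∑ j, c j * h j‖ := by
    have := norm_add_le ((ρ : ℂ) - ∑ j, c j * h j) (∑ j, c j * h j)
    simpa [abs_of_nonneg hρ0] using this
  have h3 : ‖∑ j, (c j : ℂ) * h j‖ ≤ ∑ j, |c j| * ‖h j‖ := by
    refine (norm_sum_le _ _).trans (le_of_eq ?_)
    simp
  have h4 : (∑ j, |c j| * ‖h j‖) ^ 2 ≤ ρ * ∑ j, ‖h j‖ ^ 2 := by
    have := Finset.sum_mul_sq_le_sq_mul_sq Finset.univ (fun j => |c j|) (fun j => ‖h j‖)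
    simpa [sq_abs, ← hρ] using this
  have h5 : ρ ≤ 4 * ∑ j, ‖h j‖ ^ 2 := by
    rcases hρ0.eq_or_lt with h0 | h0
    · rw [← h0]; positivity
    · have h6 : (ρ / 2) ^ 2 ≤ ρ * ∑ j, ‖h j‖ ^ 2 :=
        (pow_le_pow_left₀ (by positivity) (by linarith) 2).trans h4
      nlinarith
  refine (ENNReal.ofReal_le_ofReal h5).trans (le_of_eq ?_)
  rw [ENNReal.ofReal_mul (by norm_num), ENNReal.ofReal_sum_of_nonneg (fun _ _ => by positivity)]
  simp [← ofReal_norm, ENNReal.ofReal_pow, hh]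

/-- Rumin's inequality: the density of a Dirichlet-orthonormal family of `N` functions satisfies
`∫ ρ ^ (n / (n - 2)) ≤ C N`. -/
theorem lintegral_sum_sq_le (h3 : 3 ≤ Module.finrank ℝ E) {ι : Type*} [Fintype ι] {u : ι → E → ℝ}
    (hu : ∀ j, Differentiable ℝ (u j)) {F : ι → 𝓢(E, ℂ)} (hF : ∀ j x, F j x = u j x)
    (horth : ∀ c : ι → ℝ, ∫⁻ x, ‖fderiv ℝ (fun y => ∑ j, c j * u j y) x‖ₑ ^ 2
      = ENNReal.ofReal (∑ j, c j ^ 2))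
    {A : ℝ} (hA : A = Module.finrank ℝ E * volume.real (Metric.ball (0 : E) 1)
        / (4 * Real.pi ^ 2 * (Module.finrank ℝ E - 2))) :
    ∫⁻ x, ENNReal.ofReal ((∑ j, u j x ^ 2) *
        ((∑ j, u j x ^ 2) / (4 * A)) ^ (2 / ((Module.finrank ℝ E : ℝ) - 2)))
      ≤ ENNReal.ofReal (Fintype.card ι / Real.pi ^ 2) := by
  have : Nontrivial E := Module.nontrivial_of_finrank_pos (R := ℝ) (by omega)
  have hn : (3 : ℝ) ≤ Module.finrank ℝ E := by exact_mod_cast h3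
  have hA0 : 0 < A := by
    have : 0 < volume.real (Metric.ball (0 : E) 1) :=
      ENNReal.toReal_pos (Metric.measure_ball_pos _ _ one_pos).ne' measure_ball_lt_top.ne
    have : (0 : ℝ) < Module.finrank ℝ E - 2 := by linarith
    rw [hA]; positivity
  set m : ℝ := (Module.finrank ℝ E : ℝ) - 2 with hm
  have hm0 : 0 < m := by linarith
  have hmN : ((Module.finrank ℝ E - 2 : ℕ) : ℝ) = m := by
    rw [hm]; push_cast [show 2 ≤ Module.finrank ℝ E by omega]; rfl
  have key : ∀ x, ENNReal.ofReal ((∑ j, u j x ^ 2) * ((∑ j, u j x ^ 2) / (4 * A)) ^ (2 / m))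
      ≤ 8 * ∑ j, ∫⁻ κ in Set.Ioi (0 : ℝ),
        ENNReal.ofReal κ * ‖highFreq κ (𝓕⁻ (F j) : 𝓢(E, ℂ)) x‖ₑ ^ 2 := by
    intro x
    set ρ := ∑ j, u j x ^ 2 with hρ
    have hρ0 : 0 ≤ ρ := Finset.sum_nonneg fun _ _ => sq_nonneg _
    set b := (ρ / (4 * A)) ^ (1 / m) with hb
    have hb0 : 0 ≤ b := by positivity
    have hb2 : (ρ / (4 * A)) ^ (2 / m) = b ^ 2 := by
      rw [hb, ← Real.rpow_natCast, ← Real.rpow_mul (by positivity)]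
      congr 1; push_cast; ring
    have hmeas : ∀ j, Measurable fun κ : ℝ =>
        ENNReal.ofReal κ * ‖highFreq κ (𝓕⁻ (F j) : 𝓢(E, ℂ)) x‖ₑ ^ 2 := fun j =>
      (by fun_prop : Measurable fun κ : ℝ => ENNReal.ofReal κ).mul
        (((measurable_highFreq (𝓕⁻ (F j))).comp measurable_prodMk_right).enorm.pow_const 2)
    calc ENNReal.ofReal (ρ * (ρ / (4 * A)) ^ (2 / m))
        = 2 * ∫⁻ κ in Set.Ioc 0 b, ENNReal.ofReal κ * ENNReal.ofReal ρ := by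
          rw [lintegral_mul_const _ (by fun_prop), lintegral_Ioc_ofReal hb0, hb2,
            ← ENNReal.ofReal_mul (by positivity), ← ENNReal.ofReal_ofNat 2,
            ← ENNReal.ofReal_mul (by norm_num)]
          congr 1; ring
      _ ≤ 2 * ∫⁻ κ in Set.Ioc 0 b, 4 * ∑ j,
          ENNReal.ofReal κ * ‖highFreq κ (𝓕⁻ (F j) : 𝓢(E, ℂ)) x‖ₑ ^ 2 := by
          refine mul_le_mul_right (setLIntegral_mono' measurableSet_Ioc fun κ hκ => ?_) _
          rw [← Finset.mul_sum, mul_left_comm]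
          refine mul_le_mul_right ?_ _
          refine sum_sq_le_highFreq hu hF horth (a := A * κ ^ (Module.finrank ℝ E - 2))
            (by have := hκ.1; positivity) ?_ x ?_
          · rw [lintegral_ball_norm_zpow h3 hκ.1, hA]
          · have h1 : κ ^ (Module.finrank ℝ E - 2) ≤ ρ / (4 * A) := by
              rw [← Real.rpow_natCast, hmN]
              refine (Real.rpow_le_rpow hκ.1.le hκ.2 hm0.le).trans (le_of_eq ?_)
              rw [hb, ← Real.rpow_mul (by positivity), one_div_mul_cancel hm0.ne', Real.rpow_one]
            rw [le_div_iff₀ (by positivity)] at h1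
            linarith
      _ = 8 * ∑ j, ∫⁻ κ in Set.Ioc 0 b,
          ENNReal.ofReal κ * ‖highFreq κ (𝓕⁻ (F j) : 𝓢(E, ℂ)) x‖ₑ ^ 2 := by
          rw [lintegral_const_mul _ (Finset.measurable_fun_sum _ fun j _ => hmeas j),
            lintegral_finsetSum _ fun j _ => hmeas j, ← mul_assoc]
          norm_num
      _ ≤ _ := by
          gcongr
          exact Set.Ioc_subset_Ioi_self
  have hDj : ∀ j, ∫⁻ ξ, ENNReal.ofReal (‖ξ‖ ^ 2 / 2) * ‖(𝓕⁻ (F j)) ξ‖ₑ ^ 2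
      = ENNReal.ofReal (1 / (8 * Real.pi ^ 2)) := by
    classical
    intro j
    have h1 := horth (Pi.single j 1)
    have h2 : (fun y => ∑ i, (Pi.single j 1 : ι → ℝ) i * u i y) = u j := by
      ext y; simp [Pi.single_apply]
    rw [h2, ← lintegral_enorm_sq_fderiv (hu j) (F j) (hF j)] at h1
    have h3 : ∀ ξ : E, ENNReal.ofReal (‖ξ‖ ^ 2 / 2) = ENNReal.ofReal (1 / (8 * Real.pi ^ 2))
        * ENNReal.ofReal ((2 * Real.pi * ‖ξ‖) ^ 2) := by
      intro ξ
      rw [← ENNReal.ofReal_mul (by positivity)]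
      congr 1; field_simp; ring
    have hc := (𝓕⁻ (F j)).continuous
    simp_rw [h3, mul_assoc (ENNReal.ofReal _)]
    rw [lintegral_const_mul _ (by fun_prop), h1]
    simp [Pi.single_apply]
  refine (lintegral_mono key).trans (le_of_eq ?_)
  have hmeas : ∀ j, Measurable fun x : E => ∫⁻ κ in Set.Ioi (0 : ℝ),
      ENNReal.ofReal κ * ‖highFreq κ (𝓕⁻ (F j) : 𝓢(E, ℂ)) x‖ₑ ^ 2 := fun j => by
    have := (measurable_highFreq (𝓕⁻ (F j))).comp measurable_swap
    simp only [Function.comp_def, Prod.fst_swap, Prod.snd_swap] at this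
    exact Measurable.lintegral_prod_right'
      (f := fun q : E × ℝ => ENNReal.ofReal q.2 * ‖highFreq q.2 (𝓕⁻ (F j) : 𝓢(E, ℂ)) q.1‖ₑ ^ 2)
      ((by fun_prop : Measurable fun q : E × ℝ => ENNReal.ofReal q.2).mul (this.enorm.pow_const 2))
  rw [lintegral_const_mul _ (Finset.measurable_fun_sum _ fun j _ => hmeas j),
    lintegral_finsetSum _ fun j _ => hmeas j]
  simp_rw [lintegral_lintegral_highFreq, hDj]
  rw [Finset.sum_const, nsmul_eq_mul, Finset.card_univ, ← ENNReal.ofReal_natCast,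
    ← ENNReal.ofReal_ofNat 8, ← ENNReal.ofReal_mul (by positivity),
    ← ENNReal.ofReal_mul (by norm_num)]
  congr 1
  field_simp

/-- A finite-dimensional space of test functions has a basis that is orthonormal for the Dirichlet
integral. -/
theorem exists_dirichlet_orthonormal [Nontrivial E] (M : Submodule ℝ (E → ℝ))
    [FiniteDimensional ℝ M]
    (hM : ∀ u ∈ M, ContDiff ℝ (⊤ : ℕ∞) u ∧ HasCompactSupport u) :
    ∃ u : Fin (Module.finrank ℝ M) → E → ℝ, (∀ j, u j ∈ M) ∧
      ∀ c : Fin (Module.finrank ℝ M) → ℝ,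
        ∫⁻ x, ‖fderiv ℝ (fun y => ∑ j, c j * u j y) x‖ₑ ^ 2 = ENNReal.ofReal (∑ j, c j ^ 2) := by
  have hdiff : ∀ u ∈ M, Differentiable ℝ u := fun u hu => (hM u hu).1.differentiable (by simp)
  have hfc : ∀ u ∈ M, Continuous (fderiv ℝ u) := fun u hu =>
    (hM u hu).1.continuous_fderiv (by simp)
  have hmem : ∀ u ∈ M, MemLp (gradient u) 2 (volume : Measure E) := fun u hu =>
    Continuous.memLp_of_hasCompactSupport
      ((InnerProductSpace.toDual ℝ E).symm.continuous.comp (hfc u hu))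
      (((hM u hu).2.fderiv ℝ).comp_left (map_zero _))
  let T : M →ₗ[ℝ] Lp E 2 (volume : Measure E) :=
    { toFun := fun u => (hmem u u.2).toLp _
      map_add' := fun u v => by
        rw [← MemLp.toLp_add]
        refine MemLp.toLp_congr _ _ (Filter.Eventually.of_forall fun x => ?_)
        simp [gradient, fderiv_add (hdiff u u.2 x) (hdiff v v.2 x)]
      map_smul' := fun c u => by
        rw [RingHom.id_apply, ← MemLp.toLp_const_smul]
        refine MemLp.toLp_congr _ _ (Filter.Eventually.of_forall fun x => ?_)
        simp [gradient, fderiv_const_smul (hdiff u u.2 x)] }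
  have hnorm : ∀ u : M, ENNReal.ofReal (‖T u‖ ^ 2) = ∫⁻ x, ‖fderiv ℝ (u : E → ℝ) x‖ₑ ^ 2 := by
    intro u
    have h1 : ‖T u‖ₑ = eLpNorm (gradient (u : E → ℝ)) 2 volume := Lp.enorm_toLp (hmem u u.2)
    rw [ENNReal.ofReal_pow (norm_nonneg _), ofReal_norm, h1,
      eLpNorm_eq_lintegral_rpow_enorm_toReal (by norm_num) (by norm_num), ← ENNReal.rpow_natCast,
      ← ENNReal.rpow_mul]
    simp [gradient, ← ofReal_norm]
  have hinj : Function.Injective T := by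
    rw [← LinearMap.ker_eq_bot, LinearMap.ker_eq_bot']
    intro u hu
    have h1 := hnorm u
    rw [hu, norm_zero, zero_pow two_ne_zero, ENNReal.ofReal_zero, eq_comm,
      lintegral_eq_zero_iff' (by have := hfc u u.2; fun_prop)] at h1
    have h2 : fderiv ℝ (u : E → ℝ) = fun _ => 0 := by
      refine (Continuous.ae_eq_iff_eq volume (hfc u u.2) continuous_const).1 ?_
      filter_upwards [h1] with x hx
      have h0 : ‖fderiv ℝ (u : E → ℝ) x‖ₑ = 0 := by simpa using hx
      rw [← ofReal_norm, ENNReal.ofReal_eq_zero] at h0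
      exact norm_le_zero_iff.1 h0
    obtain ⟨x₀, hx₀⟩ : ∃ x₀, (u : E → ℝ) x₀ = 0 := by
      by_contra! h
      have h3 : tsupport (u : E → ℝ) = Set.univ := by
        rw [tsupport, Function.support_eq_univ h, closure_univ]
      have h4 := (hM u u.2).2
      rw [HasCompactSupport, h3] at h4
      have : NoncompactSpace E := NormedSpace.noncompactSpace ℝ E
      exact noncompact_univ E h4
    ext x
    rw [is_const_of_fderiv_eq_zero (hdiff u u.2) (fun x => congrFun h2 x) x x₀, hx₀]
    rfl
  have hfr : Module.finrank ℝ (LinearMap.range T) = Module.finrank ℝ M :=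
    LinearMap.finrank_range_of_inj hinj
  let b := (stdOrthonormalBasis ℝ (LinearMap.range T)).reindex (finCongr hfr)
  choose v hv using fun j => (b j).2
  refine ⟨fun j => v j, fun j => (v j).2, fun c => ?_⟩
  have h1 := hnorm (∑ j, c j • v j)
  have h2 : ((∑ j, c j • v j : M) : E → ℝ) = fun y => ∑ j, c j * (v j : E → ℝ) y := by
    ext y
    simp
  have h3 : T (∑ j, c j • v j) = ((∑ j, c j • b j : LinearMap.range T) : Lp E 2 volume) := by
    simp [map_sum, hv]
  rw [← h2, ← h1, h3, ← Submodule.coe_norm, ← real_inner_self_eq_norm_sq, b.orthonormal.inner_sum]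
  simp [sq]

set_option maxHeartbeats 1000000 in
/-- A Cwikel–Lieb–Rozenblum bound for test functions supported in `U`, with the norm
`‖w‖_{L^{n/2}}` replaced by an interpolation between `L¹` and `L^p`. -/
theorem finrank_rpow_le (h3 : 3 ≤ Module.finrank ℝ E) {U : Set E}
    {w : E → ℝ} (hw : Measurable w) (hw0 : ∀ x, 0 ≤ w x) {p θ₁ θ₂ : ℝ} (hθ₁ : 0 < θ₁)
    (hθ₂ : 0 < θ₂) (hp : 0 < p) (hsum : θ₁ + θ₂ = 2 / Module.finrank ℝ E)
    (hexp : θ₁ + p * θ₂ = 1)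
    (hw1 : IntegrableOn w U) (hwp : IntegrableOn (fun x => w x ^ p) U) {lam : ℝ} (hlam : 0 ≤ lam)
    (M : Submodule ℝ (E → ℝ)) [FiniteDimensional ℝ M]
    (hM : ∀ u ∈ M, ContDiff ℝ (⊤ : ℕ∞) u ∧ HasCompactSupport u ∧ tsupport u ⊆ U ∧
      (∫ x in U, ‖fderiv ℝ u x‖ ^ 2) ≤ lam * ∫ x in U, (u x) ^ 2 * w x)
    {A : ℝ} (hA : A = Module.finrank ℝ E * volume.real (Metric.ball (0 : E) 1)
        / (4 * Real.pi ^ 2 * (Module.finrank ℝ E - 2)))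
    (hpos : 0 < Module.finrank ℝ M) :
    (Module.finrank ℝ M : ℝ) ^ (2 / (Module.finrank ℝ E : ℝ))
      ≤ (4 * A) ^ (2 / (Module.finrank ℝ E : ℝ))
        * (1 / Real.pi ^ 2) ^ (((Module.finrank ℝ E : ℝ) - 2) / Module.finrank ℝ E)
        * (lam * (∫ x in U, w x) ^ θ₁ * (∫ x in U, w x ^ p) ^ θ₂) := by
  have : Nontrivial E := Module.nontrivial_of_finrank_pos (R := ℝ) (by omega)
  have hn : (3 : ℝ) ≤ Module.finrank ℝ E := by exact_mod_cast h3
  have hex := exists_dirichlet_orthonormal M fun u hu => ⟨(hM u hu).1, (hM u hu).2.1⟩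
  generalize Module.finrank ℝ M = N at hex hpos ⊢
  obtain ⟨u, huM, horth⟩ := hex
  set n : ℝ := (Module.finrank ℝ E : ℝ) with hnE
  have hn2 : 0 < n - 2 := by linarith
  have hN0 : (0 : ℝ) < N := by exact_mod_cast hpos
  have hA0 : 0 < A := by
    have : 0 < volume.real (Metric.ball (0 : E) 1) :=
      ENNReal.toReal_pos (Metric.measure_ball_pos _ _ one_pos).ne' measure_ball_lt_top.ne
    rw [hA]; positivity
  have hdiff : ∀ j, Differentiable ℝ (u j) := fun j =>
    (hM _ (huM j)).1.differentiable (by simp)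
  let F : Fin N → 𝓢(E, ℂ) := fun j => HasCompactSupport.toSchwartzMap (f := fun x => (u j x : ℂ))
    ((hM _ (huM j)).2.1.comp_left Complex.ofReal_zero)
    (Complex.ofRealCLM.contDiff.comp (hM _ (huM j)).1)
  have hrumin := lintegral_sum_sq_le h3 hdiff (F := F) (fun j x => rfl) horth hA
  rw [Fintype.card_fin, ← hnE] at hrumin
  set ρ : E → ℝ := fun x => ∑ j, u j x ^ 2 with hρ
  have hρ0 : ∀ x, 0 ≤ ρ x := fun x => Finset.sum_nonneg fun _ _ => sq_nonneg _
  have hρm : Measurable ρ := (Continuous.measurable (by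
    have := fun j => (hdiff j).continuous
    fun_prop))
  have hum : ∀ j, Measurable (u j) := fun j => (hdiff j).continuous.measurable
  -- Each basis function has unit Dirichlet integral.
  have hone : ∀ j, (1 : ℝ) ≤ lam * ∫ x in U, (u j x) ^ 2 * w x := by
    intro j
    refine le_trans (le_of_eq ?_) (hM _ (huM j)).2.2.2
    have h1 := horth (Pi.single j 1)
    have h2 : (fun y => ∑ i, (Pi.single j 1 : Fin N → ℝ) i * u i y) = u j := by
      ext y; simp [Pi.single_apply]
    rw [h2] at h1
    rw [setIntegral_eq_integral_of_forall_compl_eq_zero, integral_eq_lintegral_of_nonneg_ae]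
    · simp_rw [ENNReal.ofReal_pow (norm_nonneg _), ofReal_norm]
      rw [h1]
      simp [Pi.single_apply]
    · exact Filter.Eventually.of_forall fun x => by positivity
    · have := (hM _ (huM j)).1.continuous_fderiv (by simp)
      exact Continuous.aestronglyMeasurable (by fun_prop)
    · intro x hx
      have h3 : fderiv ℝ (u j) x = 0 := by
        by_contra h4
        exact hx ((hM _ (huM j)).2.2.1 (support_fderiv_subset ℝ h4))
      simp [h3]
  have hmain : ENNReal.ofReal N
      ≤ ENNReal.ofReal lam * ∫⁻ x in U, ENNReal.ofReal (ρ x) * ENNReal.ofReal (w x) := by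
    have h1 : (N : ℝ) ≤ lam * ∑ j, ∫ x in U, (u j x) ^ 2 * w x := by
      rw [Finset.mul_sum]
      simpa using Finset.sum_le_sum fun j (_ : j ∈ Finset.univ) => hone j
    refine (ENNReal.ofReal_le_ofReal h1).trans ?_
    rw [ENNReal.ofReal_mul hlam, ENNReal.ofReal_sum_of_nonneg fun j _ =>
      integral_nonneg fun x => mul_nonneg (sq_nonneg _) (hw0 x)]
    gcongr
    calc _ ≤ ∑ j, ∫⁻ x in U, ENNReal.ofReal ((u j x) ^ 2 * w x) := by
          refine Finset.sum_le_sum fun j _ => ?_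
          rw [integral_eq_lintegral_of_nonneg_ae (Filter.Eventually.of_forall fun x =>
            mul_nonneg (sq_nonneg _) (hw0 x)) (by
              have := hum j
              exact Measurable.aestronglyMeasurable (by fun_prop))]
          exact ENNReal.ofReal_toReal_le
      _ = _ := by
          rw [← lintegral_finsetSum _ fun j _ => by have := hum j; fun_prop]
          congr 1 with x
          rw [← ENNReal.ofReal_mul (hρ0 x), hρ, Finset.sum_mul, ENNReal.ofReal_sum_of_nonneg
            fun j _ => mul_nonneg (sq_nonneg _) (hw0 x)]
  have hα : 0 < (n - 2) / n := by positivity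
  have hholder : ∫⁻ x in U, ENNReal.ofReal (ρ x) * ENNReal.ofReal (w x)
      ≤ (∫⁻ x in U, ENNReal.ofReal (ρ x ^ (n / (n - 2)))) ^ ((n - 2) / n)
        * (∫⁻ x in U, ENNReal.ofReal (w x)) ^ θ₁
        * (∫⁻ x in U, ENNReal.ofReal (w x ^ p)) ^ θ₂ := by
    have h1 := ENNReal.lintegral_prod_norm_pow_le (μ := volume.restrict U) Finset.univ
      (f := ![fun x => ENNReal.ofReal (ρ x ^ (n / (n - 2))), fun x => ENNReal.ofReal (w x),
        fun x => ENNReal.ofReal (w x ^ p)]) (p := ![(n - 2) / n, θ₁, θ₂])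
      (by
        intro i _
        fin_cases i <;> simp <;> fun_prop)
      (by
        simp only [Fin.sum_univ_three, Matrix.cons_val]
        rw [add_assoc, hsum, ← add_div]
        exact (div_eq_one_iff_eq (by positivity)).2 (by ring))
      (by
        intro i _
        fin_cases i <;> simp <;> positivity)
    simp only [Fin.prod_univ_three, Matrix.cons_val] at h1
    refine le_trans (le_of_eq ?_) h1
    congr 1 with x
    have hwx : w x ^ θ₁ * (w x ^ p) ^ θ₂ = w x := by
      rw [← Real.rpow_mul (hw0 x), ← Real.rpow_add_of_nonneg (hw0 x) hθ₁.le (by positivity), hexp,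
        Real.rpow_one]
    have hρx : (ρ x ^ (n / (n - 2))) ^ ((n - 2) / n) = ρ x := by
      rw [← Real.rpow_mul (hρ0 x), div_mul_div_cancel₀ hn2.ne', div_self (by positivity),
        Real.rpow_one]
    rw [ENNReal.ofReal_rpow_of_nonneg (Real.rpow_nonneg (hρ0 x) _) hα.le, hρx,
      ENNReal.ofReal_rpow_of_nonneg (hw0 x) hθ₁.le,
      ENNReal.ofReal_rpow_of_nonneg (Real.rpow_nonneg (hw0 x) _) hθ₂.le, mul_assoc,
      ← ENNReal.ofReal_mul (Real.rpow_nonneg (hw0 x) _), hwx]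
  have hρint : ∫⁻ x in U, ENNReal.ofReal (ρ x ^ (n / (n - 2)))
      ≤ ENNReal.ofReal ((4 * A) ^ (2 / (n - 2)) * (N / Real.pi ^ 2)) := by
    refine (setLIntegral_le_lintegral _ _).trans ?_
    rw [ENNReal.ofReal_mul (by positivity)]
    refine le_trans (le_of_eq ?_) (mul_le_mul_right hrumin _)
    rw [← lintegral_const_mul _ (by fun_prop)]
    congr 1 with x
    rw [← ENNReal.ofReal_mul (by positivity), Real.div_rpow (hρ0 x) (by positivity)]
    congr 1
    have h1 : n / (n - 2) = 1 + 2 / (n - 2) := by field_simp; ring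
    rw [h1, Real.rpow_add_of_nonneg (hρ0 x) (by norm_num) (by positivity), Real.rpow_one]
    field_simp
    exact mul_comm _ _
  have hreal : (N : ℝ) ≤ lam * (((4 * A) ^ (2 / (n - 2)) * (N / Real.pi ^ 2)) ^ ((n - 2) / n)
      * (∫ x in U, w x) ^ θ₁ * (∫ x in U, w x ^ p) ^ θ₂) := by
    have hW1 : 0 ≤ ∫ x in U, w x := integral_nonneg hw0
    have hWp : 0 ≤ ∫ x in U, w x ^ p := integral_nonneg fun x => Real.rpow_nonneg (hw0 x) _
    rw [← ENNReal.ofReal_le_ofReal_iff (by positivity)]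
    refine (hmain.trans (mul_le_mul_right hholder _)).trans ?_
    rw [ENNReal.ofReal_mul hlam, ENNReal.ofReal_mul (by positivity),
      ENNReal.ofReal_mul (by positivity), ← ENNReal.ofReal_rpow_of_nonneg (by positivity) hα.le,
      ← ENNReal.ofReal_rpow_of_nonneg hW1 hθ₁.le, ← ENNReal.ofReal_rpow_of_nonneg hWp hθ₂.le,
      ofReal_integral_eq_lintegral_ofReal hw1 (Filter.Eventually.of_forall hw0),
      ofReal_integral_eq_lintegral_ofReal hwp (Filter.Eventually.of_forall fun x =>
        Real.rpow_nonneg (hw0 x) _)]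
    gcongr
  have hsplit : (N : ℝ) = N ^ (2 / n) * N ^ ((n - 2) / n) := by
    rw [← Real.rpow_add hN0, ← add_div, add_sub_cancel, div_self (by positivity), Real.rpow_one]
  have hfac : ((4 * A) ^ (2 / (n - 2)) * (N / Real.pi ^ 2)) ^ ((n - 2) / n)
      = (4 * A) ^ (2 / n) * (1 / Real.pi ^ 2) ^ ((n - 2) / n) * N ^ ((n - 2) / n) := by
    rw [Real.mul_rpow (by positivity) (by positivity), ← Real.rpow_mul (by positivity),
      div_mul_div_cancel₀ hn2.ne', ← one_div_mul_eq_div (Real.pi ^ 2), Real.mul_rpow (by positivity) hN0.le]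
    ring
  rw [hfac] at hreal
  have hNα : 0 < (N : ℝ) ^ ((n - 2) / n) := Real.rpow_pos_of_pos hN0 _
  refine le_of_mul_le_mul_right ?_ hNα
  rw [← hsplit]
  refine hreal.trans (le_of_eq ?_)
  ring

end Fourier

theorem two_mul_pow_pred_le_exp_mul_factorial {n : ℕ} (hn : 1 ≤ n) :
    2 * (n : ℝ) ^ (n - 1) ≤ Real.exp n * (n - 1).factorial := by
  obtain ⟨m, rfl⟩ := Nat.exists_eq_add_of_le' hn
  have h := Real.sum_le_exp_of_nonneg (x := ((m + 1 : ℕ) : ℝ)) (by positivity) (m + 2)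
  rw [Finset.sum_range_succ, Finset.sum_range_succ] at h
  have h0 : 0 ≤ ∑ i ∈ Finset.range m, ((m + 1 : ℕ) : ℝ) ^ i / (i.factorial : ℝ) :=
    Finset.sum_nonneg fun _ _ => by positivity
  have h1 : ((m + 1 : ℕ) : ℝ) ^ (m + 1) / ((m + 1).factorial : ℝ)
      = ((m + 1 : ℕ) : ℝ) ^ m / (m.factorial : ℝ) := by
    rw [Nat.factorial_succ, pow_succ]
    push_cast
    field_simp
  rw [h1] at h
  rw [Nat.add_sub_cancel, ← div_le_iff₀ (by positivity)]
  calc _ = ((m + 1 : ℕ) : ℝ) ^ m / (m.factorial : ℝ)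
        + ((m + 1 : ℕ) : ℝ) ^ m / (m.factorial : ℝ) := by ring
    _ ≤ _ := by linarith

theorem rpow_half_le_exp_mul_factorial {n : ℕ} (hn : 3 ≤ n) :
    2 * ((n : ℝ) * (n - 2)) ^ ((n : ℝ) / 2)
      ≤ Real.exp n * (n - 1).factorial * (n - 2) := by
  have hx : (3 : ℝ) ≤ n := by exact_mod_cast hn
  have h2 : (0 : ℝ) < n - 2 := by linarith
  have hn0 : (0 : ℝ) < n := by linarith
  have e1 : ((n : ℝ) - 2) ^ ((n : ℝ) / 2) ≤ (n - 2) * (n : ℝ) ^ ((n : ℝ) / 2 - 1) := by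
    calc ((n : ℝ) - 2) ^ ((n : ℝ) / 2) = (n - 2) * ((n : ℝ) - 2) ^ ((n : ℝ) / 2 - 1) := by
          rw [Real.rpow_sub_one h2.ne', mul_div_cancel₀ _ h2.ne']
      _ ≤ _ := by
          gcongr
          · linarith
          · linarith
  calc 2 * ((n : ℝ) * (n - 2)) ^ ((n : ℝ) / 2)
      = 2 * ((n : ℝ) ^ ((n : ℝ) / 2) * ((n : ℝ) - 2) ^ ((n : ℝ) / 2)) := by
        rw [Real.mul_rpow hn0.le h2.le]
    _ ≤ 2 * ((n : ℝ) ^ ((n : ℝ) / 2) * ((n - 2) * (n : ℝ) ^ ((n : ℝ) / 2 - 1))) := by gcongr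
    _ = 2 * (n : ℝ) ^ (n - 1) * (n - 2) := by
        have : (n : ℝ) ^ ((n : ℝ) / 2) * (n : ℝ) ^ ((n : ℝ) / 2 - 1) = (n : ℝ) ^ (n - 1) := by
          rw [← Real.rpow_add hn0, ← Real.rpow_natCast, Nat.cast_sub (by omega)]
          congr 1
          push_cast
          ring
        rw [← this]
        ring
    _ ≤ _ := mul_le_mul_of_nonneg_right (two_mul_pow_pred_le_exp_mul_factorial (by omega)) h2.le

/-- The constant of `finrank_rpow_le` is at most `e²` times the sharp Sobolev constant. -/
theorem rumin_const_le_exp_two_mul_sobolev {n : ℕ} (hn : 3 ≤ n) {A : ℝ}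
    (hA : A = n * volume.real (Metric.ball (0 : EuclideanSpace ℝ (Fin n)) 1)
      / (4 * Real.pi ^ 2 * (n - 2))) :
    (4 * A) ^ (2 / (n : ℝ)) * (1 / Real.pi ^ 2) ^ (((n : ℝ) - 2) / n)
      ≤ Real.exp 2 * (((n : ℝ) * ((n : ℝ) - 2) * Real.pi)⁻¹
        * (Real.Gamma n / Real.Gamma ((n : ℝ) / 2)) ^ ((2 : ℝ) / n)) := by
  have hx : (3 : ℝ) ≤ n := by exact_mod_cast hn
  have h2 : (0 : ℝ) < n - 2 := by linarith
  have hn0 : (0 : ℝ) < n := by linarith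
  have hπ := Real.pi_pos
  have hG : 0 < Real.Gamma ((n : ℝ) / 2) := Real.Gamma_pos_of_pos (by positivity)
  have hGn : Real.Gamma n = (n - 1).factorial := by
    rw [← Real.Gamma_nat_eq_factorial, Nat.cast_sub (by omega)]
    simp
  have hvol : volume.real (Metric.ball (0 : EuclideanSpace ℝ (Fin n)) 1)
      = Real.pi ^ ((n : ℝ) / 2) / ((n : ℝ) / 2 * Real.Gamma ((n : ℝ) / 2)) := by
    have : Nonempty (Fin n) := ⟨⟨0, by omega⟩⟩
    rw [measureReal_def, EuclideanSpace.volume_ball, ENNReal.ofReal_one, one_pow, one_mul,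
      Fintype.card_fin, ENNReal.toReal_ofReal (by positivity),
      Real.Gamma_add_one (by positivity), Real.sqrt_eq_rpow, ← Real.rpow_natCast,
      ← Real.rpow_mul hπ.le]
    congr 2
    ring
  have hpow : ∀ {y : ℝ}, 0 ≤ y → (y ^ ((n : ℝ) / 2)) ^ (2 / (n : ℝ)) = y := fun hy => by
    rw [← Real.rpow_mul hy, div_mul_div_cancel₀ two_ne_zero, div_self hn0.ne', Real.rpow_one]
  have hA4 : 4 * A = 2 * Real.pi ^ ((n : ℝ) / 2)
      / (Real.pi ^ 2 * (n - 2) * Real.Gamma ((n : ℝ) / 2)) := by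
    rw [hA, hvol]
    field_simp
  have hA0 : 0 < 4 * A := by rw [hA4]; positivity
  have hL : (1 / Real.pi ^ 2) ^ (((n : ℝ) - 2) / n)
      = (Real.pi ^ (2 - (n : ℝ))) ^ (2 / (n : ℝ)) := by
    rw [one_div, Real.inv_rpow (by positivity), ← Real.rpow_natCast, ← Real.rpow_mul hπ.le,
      ← Real.rpow_mul hπ.le, ← Real.rpow_neg hπ.le]
    congr 1
    push_cast
    ring
  have hE : Real.exp 2 = Real.exp n ^ (2 / (n : ℝ)) := by
    rw [← Real.exp_mul, mul_div_cancel₀ _ hn0.ne']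
  have hk : 0 < (n : ℝ) * ((n : ℝ) - 2) := by positivity
  rw [hL, hE, ← Real.mul_rpow hA0.le (by positivity),
    ← hpow (y := ((n : ℝ) * ((n : ℝ) - 2) * Real.pi)⁻¹) (by positivity),
    ← Real.mul_rpow (by positivity) (by rw [hGn]; positivity),
    ← Real.mul_rpow (by positivity) (by rw [hGn]; positivity)]
  refine Real.rpow_le_rpow (by positivity) ?_ (by positivity)
  have key := rpow_half_le_exp_mul_factorial hn
  have hππ : Real.pi ^ ((n : ℝ) / 2) * Real.pi ^ (2 - (n : ℝ)) * Real.pi ^ ((n : ℝ) / 2)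
      = Real.pi ^ 2 := by
    rw [← Real.rpow_add hπ, ← Real.rpow_add hπ, ← Real.rpow_natCast]
    congr 1
    push_cast
    ring
  rw [hA4, hGn, Real.inv_rpow (by positivity), Real.mul_rpow hk.le hπ.le]
  have hkp := Real.rpow_pos_of_pos hk ((n : ℝ) / 2)
  have hπp := Real.rpow_pos_of_pos hπ ((n : ℝ) / 2)
  have e1 : 2 * Real.pi ^ ((n : ℝ) / 2) / (Real.pi ^ 2 * (n - 2) * Real.Gamma ((n : ℝ) / 2))
      * Real.pi ^ (2 - (n : ℝ))
      = 2 * ((n : ℝ) * (n - 2)) ^ ((n : ℝ) / 2) * (((n : ℝ) * (n - 2)) ^ ((n : ℝ) / 2)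
        * Real.pi ^ ((n : ℝ) / 2) * (n - 2) * Real.Gamma ((n : ℝ) / 2))⁻¹ := by
    rw [← hππ]
    field_simp
  have e2 : Real.exp n * ((((n : ℝ) * (n - 2)) ^ ((n : ℝ) / 2) * Real.pi ^ ((n : ℝ) / 2))⁻¹
      * ((n - 1).factorial / Real.Gamma ((n : ℝ) / 2)))
      = Real.exp n * (n - 1).factorial * (n - 2) * (((n : ℝ) * (n - 2)) ^ ((n : ℝ) / 2)
        * Real.pi ^ ((n : ℝ) / 2) * (n - 2) * Real.Gamma ((n : ℝ) / 2))⁻¹ := by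
    field_simp
  rw [e1, e2]
  gcongr

/-- Theorem 5.4 in min–max (dimension) formulation: the dimension of any
finite-dimensional space of smooth compactly supported functions in
`U_e = {V < e}` on which the Dirichlet integral is at most `λ` times the
`L²(m_e)` norm, `m_e = (V-e)₋ dx`, is bounded by
`e^{2d} S_n^d ‖(V-e)₋‖_{L¹}² ‖(V-e)₋‖_{L^p}^{d-2} λ^d`. -/
theorem dirichlet_counting_weyl_bound
    (n : ℕ) (hn : 3 ≤ n)
    (Ω : Set (EuclideanSpace ℝ (Fin n))) (hΩ : IsOpen Ω)
    (V : EuclideanSpace ℝ (Fin n) → ℝ) (hV : Measurable V) (e : ℝ)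
    (p : ℝ) (hp : (n : ℝ) / 2 < p)
    (hw1 : IntegrableOn (fun x => max (e - V x) 0) Ω)
    (hwp : IntegrableOn (fun x => max (e - V x) 0 ^ p) Ω)
    (nstar r d Sn : ℝ)
    (hnstar : nstar = 2 * n / ((n : ℝ) - 2))
    (hr : r = nstar * (1 - 1 / p))
    (hd : d = 2 * r / (r - 2))
    (hSn : Sn = ((n : ℝ) * ((n : ℝ) - 2) * Real.pi)⁻¹
      * (Real.Gamma n / Real.Gamma ((n : ℝ) / 2)) ^ ((2 : ℝ) / n))
    (lam : ℝ) (hlam : 0 ≤ lam)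
    (M : Submodule ℝ (EuclideanSpace ℝ (Fin n) → ℝ))
    (hfin : FiniteDimensional ℝ M)
    (hM : ∀ u ∈ M, ContDiff ℝ (⊤ : ℕ∞) u ∧ HasCompactSupport u ∧
      tsupport u ⊆ {x ∈ Ω | V x < e} ∧
      (∫ x in {x ∈ Ω | V x < e}, ‖fderiv ℝ u x‖ ^ 2)
        ≤ lam * ∫ x in {x ∈ Ω | V x < e}, (u x) ^ 2 * max (e - V x) 0) :
    (Module.finrank ℝ M : ℝ)
      ≤ Real.exp (2 * d) * Sn ^ d
        * (∫ x in {x ∈ Ω | V x < e}, max (e - V x) 0) ^ 2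
        * (∫ x in {x ∈ Ω | V x < e}, max (e - V x) 0 ^ p) ^ ((d - 2) / p)
        * lam ^ d := by
  have hx : (3 : ℝ) ≤ n := by exact_mod_cast hn
  have h2 : (0 : ℝ) < n - 2 := by linarith
  have hn0 : (0 : ℝ) < n := by linarith
  have hp1 : 1 < p := by linarith
  have hp0 : 0 < p := by linarith
  have hp2 : 0 < p - 1 := by linarith
  have hr' : r = 2 * n * (p - 1) / ((n - 2) * p) := by
    rw [hr, hnstar]
    field_simp
  have hr2 : 2 < r := by
    rw [hr', lt_div_iff₀ (by positivity)]
    linarith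
  have hr0 : 0 < r := by linarith
  have hr20 : 0 < r - 2 := by linarith
  have hd0 : 0 < d := by rw [hd]; positivity
  have hd2 : 2 / d = (r - 2) / r := by
    rw [hd]
    field_simp
  have hd3 : 1 - 2 / d = 2 / r := by
    rw [hd2]
    field_simp
    ring
  have hθ₁ : 0 < 2 / d := by positivity
  have hθ₂ : 0 < (1 - 2 / d) / p := by rw [hd3]; positivity
  have hexp : 2 / d + p * ((1 - 2 / d) / p) = 1 := by
    rw [mul_div_cancel₀ _ hp0.ne']
    ring
  have hsum : 2 / d + (1 - 2 / d) / p = 2 / n := by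
    have h4 : (1 - 2 / d) * (1 - 1 / p) = (n - 2) / n := by
      rw [hd3, hr']
      field_simp
    have h5 : ((n : ℝ) - 2) / n = 1 - 2 / n := by field_simp
    linear_combination -h4 - h5
  have hdn : n ≤ 2 * d := by
    have h4 : 2 / d ≤ 2 / n := by linarith
    rw [div_le_div_iff₀ hd0 hn0] at h4
    linarith
  set U := {x ∈ Ω | V x < e} with hU
  have hsub : U ⊆ Ω := fun x hx => hx.1
  have hw0 : ∀ x, 0 ≤ max (e - V x) 0 := fun x => le_max_right _ _
  have hW1 : 0 ≤ ∫ x in U, max (e - V x) 0 := integral_nonneg hw0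
  have hWp : 0 ≤ ∫ x in U, max (e - V x) 0 ^ p :=
    integral_nonneg fun x => Real.rpow_nonneg (hw0 x) _
  have hΓ : 0 < Real.Gamma n / Real.Gamma ((n : ℝ) / 2) :=
    div_pos (Real.Gamma_pos_of_pos hn0) (Real.Gamma_pos_of_pos (by positivity))
  have hSn0 : 0 < Sn := by rw [hSn]; positivity
  rcases Nat.eq_zero_or_pos (Module.finrank ℝ M) with hN | hN
  · rw [hN, Nat.cast_zero]
    positivity
  have hmain := finrank_rpow_le (E := EuclideanSpace ℝ (Fin n)) (by simpa using hn)
    (by fun_prop) hw0 hθ₁ hθ₂ hp0 (by simpa using hsum) hexp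
    (hw1.mono_set hsub) (hwp.mono_set hsub) hlam M hM rfl hN
  rw [finrank_euclideanSpace_fin] at hmain
  have hN1 : (1 : ℝ) ≤ Module.finrank ℝ M := by exact_mod_cast hN
  have hbound : (Module.finrank ℝ M : ℝ) ^ (2 / (n : ℝ)) ≤ Real.exp 2 * Sn *
      (lam * (∫ x in U, max (e - V x) 0) ^ (2 / d)
        * (∫ x in U, max (e - V x) 0 ^ p) ^ ((1 - 2 / d) / p)) := by
    refine hmain.trans (mul_le_mul_of_nonneg_right ?_ (by positivity))
    rw [hSn]
    exact rumin_const_le_exp_two_mul_sobolev hn rfl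
  calc (Module.finrank ℝ M : ℝ) = (Module.finrank ℝ M : ℝ) ^ (1 : ℝ) := (Real.rpow_one _).symm
    _ ≤ (Module.finrank ℝ M : ℝ) ^ (2 / (n : ℝ) * d) := by
        refine Real.rpow_le_rpow_of_exponent_le hN1 ?_
        rw [div_mul_eq_mul_div, le_div_iff₀ hn0]
        linarith
    _ = ((Module.finrank ℝ M : ℝ) ^ (2 / (n : ℝ))) ^ d := Real.rpow_mul (by positivity) _ _
    _ ≤ _ := Real.rpow_le_rpow (by positivity) hbound hd0.le
    _ = _ := by
        rw [Real.mul_rpow (by positivity) (by positivity), Real.mul_rpow (by positivity)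
          hSn0.le, Real.mul_rpow (by positivity) (by positivity), Real.mul_rpow hlam
          (by positivity), ← Real.rpow_mul hW1, ← Real.rpow_mul hWp, ← Real.exp_mul,
          div_mul_cancel₀ _ hd0.ne', Real.rpow_two,
          show (1 - 2 / d) / p * d = (d - 2) / p by field_simp]
        ring
end

section
/- Let (X, m) be a measure space, let r > 2, set d := 2r/(r − 2), and let S, E > 0 and ε > 0 be real numbers. Let u : X → ℝ be measurable with ∫_X |u|² dm = 1, with (∫_X |u|^r dm)^{2/r} ≤ S·E, and such that x ↦ |u(x)|²·ln|u(x)| is m-integrable. Then ∫_X |u|² ln|u| dm ≤ (d/4)·(−ln ε + ε·S·E). -/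
open MeasureTheory

/-- A nonnegative function with lower integral at most `K` is integrable with integral at most
`K`. -/
lemma integrable_and_integral_le_of_lintegral_ofReal_le {X : Type*} [MeasurableSpace X]
    {m : Measure X} {f : X → ℝ} {K : ℝ} (hf : AEStronglyMeasurable f m) (hf0 : 0 ≤ f)
    (hK : 0 ≤ K) (h : ∫⁻ x, ENNReal.ofReal (f x) ∂m ≤ ENNReal.ofReal K) :
    Integrable f m ∧ ∫ x, f x ∂m ≤ K := by
  refine ⟨⟨hf, ?_⟩, ?_⟩
  · rw [hasFiniteIntegral_iff_ofReal (.of_forall hf0)]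
    exact h.trans_lt ENNReal.ofReal_lt_top
  · rw [integral_eq_lintegral_of_nonneg_ae (.of_forall hf0) hf]
    exact ENNReal.toReal_le_of_le_ofReal hK h

/-- The tangent-line bound `log t ≤ t / K - 1 + log K` at `t = |y| ^ (r - 2)`, multiplied
by `y ^ 2`. -/
lemma sub_two_mul_sq_mul_log_abs_le {r K : ℝ} (hr : 2 < r) (hK : 0 < K) (y : ℝ) :
    (r - 2) * (y ^ 2 * Real.log |y|) ≤ |y| ^ r / K + y ^ 2 * (Real.log K - 1) := by
  rcases eq_or_ne y 0 with rfl | hy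
  · simp [Real.zero_rpow (by linarith : r ≠ 0)]
  have hy' : 0 < |y| := abs_pos.mpr hy
  have hpos : 0 < |y| ^ (r - 2) := Real.rpow_pos_of_pos hy' _
  have hlog : (r - 2) * Real.log |y| - Real.log K ≤ |y| ^ (r - 2) / K - 1 := by
    have := Real.log_le_sub_one_of_pos (div_pos hpos hK)
    rwa [Real.log_div hpos.ne' hK.ne', Real.log_rpow hy'] at this
  have hpow : |y| ^ r = y ^ 2 * |y| ^ (r - 2) := by
    rw [Real.rpow_sub hy', Real.rpow_two, sq_abs]
    field_simp
  rw [hpow, mul_div_assoc]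
  nlinarith [mul_le_mul_of_nonneg_left hlog (sq_nonneg y)]

/-- The logarithmic form of Jensen's inequality for the probability measure `u ^ 2 · m`. -/
lemma sub_two_mul_integral_sq_mul_log_abs_le {X : Type*} [MeasurableSpace X] {m : Measure X}
    {r K : ℝ} (hr : 2 < r) (hK : 0 < K) {u : X → ℝ}
    (hnorm : ∫ x, (u x) ^ 2 ∂m = 1) (hint : Integrable (fun x => |u x| ^ r) m)
    (hle : ∫ x, |u x| ^ r ∂m ≤ K)
    (hlog : Integrable (fun x => (u x) ^ 2 * Real.log |u x|) m) :
    (r - 2) * ∫ x, (u x) ^ 2 * Real.log |u x| ∂m ≤ Real.log K := by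
  have hsq : Integrable (fun x => (u x) ^ 2) m :=
    .of_integral_ne_zero (by rw [hnorm]; exact one_ne_zero)
  calc (r - 2) * ∫ x, (u x) ^ 2 * Real.log |u x| ∂m
      = ∫ x, (r - 2) * ((u x) ^ 2 * Real.log |u x|) ∂m := (integral_const_mul _ _).symm
    _ ≤ ∫ x, (|u x| ^ r / K + (u x) ^ 2 * (Real.log K - 1)) ∂m :=
        integral_mono (hlog.const_mul _) ((hint.div_const _).add (hsq.mul_const _))
          fun x => sub_two_mul_sq_mul_log_abs_le hr hK (u x)
    _ = (∫ x, |u x| ^ r ∂m) / K + (Real.log K - 1) := by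
        rw [integral_add (hint.div_const _) (hsq.mul_const _), integral_div, integral_mul_const,
          hnorm, one_mul]
    _ ≤ Real.log K := by linarith [(div_le_one hK).mpr hle]

/-- The family of logarithmic Sobolev inequalities derived in the proof of
Lemma 5.2: a Sobolev bound `‖u‖²_{L^r(m)} ≤ S·E` for a normalized `u` implies
`∫ |u|² ln|u| dm ≤ (d/4)(-ln ε + ε S E)` for every `ε > 0`, with
`d = 2r/(r-2)`. -/
theorem log_sobolev_from_sobolev
    {X : Type*} [MeasurableSpace X] (m : Measure X)
    (r d S E ε : ℝ) (hr : 2 < r) (hd : d = 2 * r / (r - 2))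
    (hS : 0 < S) (hE : 0 < E) (hε : 0 < ε)
    (u : X → ℝ) (hu : Measurable u)
    (hnorm : ∫ x, (u x) ^ 2 ∂m = 1)
    (hsob : (∫⁻ x, ENNReal.ofReal (|u x| ^ r) ∂m) ^ ((2 : ℝ) / r)
      ≤ ENNReal.ofReal (S * E))
    (hlog : Integrable (fun x => (u x) ^ 2 * Real.log |u x|) m) :
    ∫ x, (u x) ^ 2 * Real.log |u x| ∂m ≤ (d / 4) * (-Real.log ε + ε * S * E) := by
  have hr0 : 0 < r := by linarith
  have hr2 : 0 < r - 2 := by linarith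
  have hSE : 0 < S * E := mul_pos hS hE
  have hK : 0 < (S * E) ^ (r / 2) := Real.rpow_pos_of_pos hSE _
  have hM : ∫⁻ x, ENNReal.ofReal (|u x| ^ r) ∂m ≤ ENNReal.ofReal ((S * E) ^ (r / 2)) := by
    have h := ENNReal.rpow_le_rpow hsob (by positivity : 0 ≤ r / 2)
    rwa [← ENNReal.rpow_mul, show (2 : ℝ) / r * (r / 2) = 1 by field_simp, ENNReal.rpow_one,
      ENNReal.ofReal_rpow_of_pos hSE] at h
  obtain ⟨hint, hle⟩ := integrable_and_integral_le_of_lintegral_ofReal_le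
    (hu.abs.pow_const r).aestronglyMeasurable (fun x => Real.rpow_nonneg (abs_nonneg _) _) hK.le hM
  have hJ := sub_two_mul_integral_sq_mul_log_abs_le hr hK hnorm hint hle hlog
  rw [Real.log_rpow hSE] at hJ
  have hε' : Real.log (S * E) ≤ -Real.log ε + ε * S * E := by
    have h := Real.log_le_sub_one_of_pos (mul_pos hε hSE)
    rw [Real.log_mul hε.ne' hSE.ne'] at h
    linarith
  calc ∫ x, (u x) ^ 2 * Real.log |u x| ∂m
      ≤ (r / 2 * Real.log (S * E)) / (r - 2) := by rwa [le_div_iff₀' hr2]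
    _ = d / 4 * Real.log (S * E) := by rw [hd]; field_simp; ring
    _ ≤ d / 4 * (-Real.log ε + ε * S * E) := by
        have : 0 ≤ d := by rw [hd]; positivity
        gcongr
end

section
/- Let (Y, σ) be a measure space, let k : Y → [0, ∞) be measurable with ∫_Y k^p dσ < ∞ for some p ∈ (1, ∞), and let μ := k·σ be the measure with density k with respect to σ. Let ν be a measure on Y and C ≥ 0 with ν(A) ≤ C·μ(A) for all measurable A. Let q > 2 and set s := q·(1 − 1/p), and assume s ≥ 2. Suppose φ : Y → ℝ is measurable and E, S, b ≥ 0 are real numbers such that (∫_Y |φ|^q dσ)^{2/q} ≤ S·E + b·∫_Y |φ|² dν. Then (∫_Y |φ|^s dμ)^{2/s} ≤ S·(∫_Y k^p dσ)^{2/(sp)}·E + b·C·(∫_Y k^p dσ)^{2/(sp)}·∫_Y |φ|² dμ. -/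
open MeasureTheory

/-- Hölder's inequality for a measure `k·σ` with density `k ∈ L^p(σ)`: the `s`-th moment with
respect to `k·σ`, where `s = q (1 - 1/p)`, is controlled by the `q`-th moment with respect to
`σ`. -/
theorem lintegral_withDensity_rpow_le {Y : Type*} [MeasurableSpace Y] (σ : Measure Y)
    {k : Y → ℝ} (hk : Measurable k) (hknn : ∀ y, 0 ≤ k y) {p q s : ℝ} (hp1 : 1 < p)
    (hs : s = q * (1 - 1 / p)) {φ : Y → ℝ} (hφ : Measurable φ) :
    ∫⁻ y, ENNReal.ofReal (|φ y| ^ s) ∂(σ.withDensity fun y => ENNReal.ofReal (k y))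
      ≤ (∫⁻ y, ENNReal.ofReal (k y ^ p) ∂σ) ^ (1 / p)
        * (∫⁻ y, ENNReal.ofReal (|φ y| ^ q) ∂σ) ^ (1 - 1 / p) := by
  have hp0 : 0 < p := one_pos.trans hp1
  have hpc := Real.HolderConjugate.conjExponent hp1
  have hp' : 1 / p.conjExponent = 1 - 1 / p := by
    rw [one_div, one_div, hpc.one_sub_inv]
  have hsq : s * p.conjExponent = q := by
    rw [hs, ← hp', mul_assoc, one_div_mul_cancel hpc.symm.pos.ne', mul_one]
  have hφs : Measurable fun y => ENNReal.ofReal (|φ y| ^ s) := by fun_prop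
  rw [lintegral_withDensity_eq_lintegral_mul _ hk.ennreal_ofReal hφs]
  refine (ENNReal.lintegral_mul_le_Lp_mul_Lq σ hpc hk.ennreal_ofReal.aemeasurable
    hφs.aemeasurable).trans_eq ?_
  rw [hp']
  congr 3 <;> ext y
  · exact ENNReal.ofReal_rpow_of_nonneg (hknn y) hp0.le
  · rw [ENNReal.ofReal_rpow_of_nonneg (by positivity) hpc.symm.nonneg,
      ← Real.rpow_mul (abs_nonneg _), hsq]

/-- Lemma 5.9 in abstract form: a Sobolev-type inequality
`‖φ‖²_{L^q(σ)} ≤ S·E + b‖φ‖²_{L²(ν)}` together with a density `k = dμ/dσ` in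
`L^p(σ)` and a domination `ν ≤ C·μ` yields
`‖φ‖²_{L^s(μ)} ≤ S‖k‖_p^{2/s}·E + bC‖k‖_p^{2/s}‖φ‖²_{L²(μ)}`,
where `s = q(1 - 1/p)`. -/
theorem weighted_boundary_sobolev
    {Y : Type*} [MeasurableSpace Y] (σ : Measure Y)
    (k : Y → ℝ) (hk : Measurable k) (hknn : ∀ y, 0 ≤ k y)
    (p : ℝ) (hp1 : 1 < p)
    (hkp : ∫⁻ y, ENNReal.ofReal (k y ^ p) ∂σ < ⊤)
    (ν : Measure Y) (C : ℝ) (hC : 0 ≤ C)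
    (hν : ∀ A : Set Y, MeasurableSet A →
      ν A ≤ ENNReal.ofReal C * (σ.withDensity fun y => ENNReal.ofReal (k y)) A)
    (q s : ℝ) (hq : 2 < q) (hs : s = q * (1 - 1 / p)) (hs2 : 2 ≤ s)
    (φ : Y → ℝ) (hφ : Measurable φ)
    (E S b : ℝ) (hE : 0 ≤ E) (hS : 0 ≤ S) (hb : 0 ≤ b)
    (hsob : (∫⁻ y, ENNReal.ofReal (|φ y| ^ q) ∂σ) ^ ((2 : ℝ) / q)
      ≤ ENNReal.ofReal (S * E)
        + ENNReal.ofReal b * ∫⁻ y, ENNReal.ofReal ((φ y) ^ 2) ∂ν) :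
    (∫⁻ y, ENNReal.ofReal (|φ y| ^ s)
        ∂(σ.withDensity fun y => ENNReal.ofReal (k y))) ^ ((2 : ℝ) / s)
      ≤ ENNReal.ofReal S * (∫⁻ y, ENNReal.ofReal (k y ^ p) ∂σ) ^ ((2 : ℝ) / (s * p))
          * ENNReal.ofReal E
        + ENNReal.ofReal b * ENNReal.ofReal C
          * (∫⁻ y, ENNReal.ofReal (k y ^ p) ∂σ) ^ ((2 : ℝ) / (s * p))
          * ∫⁻ y, ENNReal.ofReal ((φ y) ^ 2)
              ∂(σ.withDensity fun y => ENNReal.ofReal (k y)) := by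
  have hp0 : 0 < p := one_pos.trans hp1
  have hq0 : 0 < q := two_pos.trans hq
  have hs0 : 0 < s := two_pos.trans_le hs2
  set μ := σ.withDensity fun y => ENNReal.ofReal (k y) with hμ
  set K := ∫⁻ y, ENNReal.ofReal (k y ^ p) ∂σ
  have hνμ : ν ≤ ENNReal.ofReal C • μ := Measure.le_iff.2 hν
  have hL2 : ∫⁻ y, ENNReal.ofReal ((φ y) ^ 2) ∂ν
      ≤ ENNReal.ofReal C * ∫⁻ y, ENNReal.ofReal ((φ y) ^ 2) ∂μ := by
    calc _ ≤ ∫⁻ y, ENNReal.ofReal ((φ y) ^ 2) ∂(ENNReal.ofReal C • μ) :=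
          lintegral_mono' hνμ le_rfl
      _ = _ := by rw [lintegral_smul_measure, smul_eq_mul]
  have hsq : 1 - 1 / p = s / q := by rw [hs]; field_simp
  have hmain := lintegral_withDensity_rpow_le σ hk hknn hp1 hs hφ
  rw [hsq] at hmain
  calc (∫⁻ y, ENNReal.ofReal (|φ y| ^ s) ∂μ) ^ ((2 : ℝ) / s)
      ≤ (K ^ (1 / p) * (∫⁻ y, ENNReal.ofReal (|φ y| ^ q) ∂σ) ^ (s / q)) ^ ((2 : ℝ) / s) :=
        ENNReal.rpow_le_rpow hmain (by positivity)
    _ = K ^ ((2 : ℝ) / (s * p))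
          * (∫⁻ y, ENNReal.ofReal (|φ y| ^ q) ∂σ) ^ ((2 : ℝ) / q) := by
        rw [ENNReal.mul_rpow_of_nonneg _ _ (by positivity), ← ENNReal.rpow_mul,
          ← ENNReal.rpow_mul]
        congr 2 <;> field_simp
    _ ≤ K ^ ((2 : ℝ) / (s * p)) * (ENNReal.ofReal (S * E) + ENNReal.ofReal b
          * (ENNReal.ofReal C * ∫⁻ y, ENNReal.ofReal ((φ y) ^ 2) ∂μ)) := by
        gcongr
        exact hsob.trans (by gcongr)
    _ = _ := by
        rw [ENNReal.ofReal_mul hS]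
        ring
end
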